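/- arXiv:2501.12939 — 3 statements merged into one kernel-verified Lean document; each statement's English description precedes it below -/
import Mathlib

section
/- Let p > 1 and T > 0. A function u ∈ W_{pw}^{1,p,+}(-T,T) with u not identically zero satisfies ∫_{-T}^T ((u'(t))^+)^p dt = λ^+_p(-T,T) ∫_{-T}^T |u(t)|^p dt if and only if, for some constant c > 0, either u(t) = c·φ_p((t-T)/2) for all t ∈ (-T,T) or u(t) = -c·φ_p((t+T)/2) for all t ∈ (-T,T). In particular every extremizer belongs to W^{1,p}(-T,T) \ W^{1,p}_0(-T,T), vanishes at exactly one endpoint of (-T,T), and has definite sign. -/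
open MeasureTheory Filter Set
open scoped Topology RealInnerProductSpace

noncomputable section

/-- Positive part. -/
def ppart (t : ℝ) : ℝ := max t 0
/-- Negative part. -/
def npart (t : ℝ) : ℝ := max (-t) 0

/-- `u ∈ W^{1,p}(α,β)` (continuous representative on `[α,β]`), with weak derivative `u'`. -/
def MemW1pC (p α β : ℝ) (u u' : ℝ → ℝ) : Prop :=
  IntervalIntegrable u' volume α β ∧
  (∀ t ∈ Set.Icc α β, u t = u α + ∫ s in α..t, u' s) ∧
  IntegrableOn (fun t => |u' t| ^ p) (Set.Ioo α β) volume

/-- `u ∈ W^{1,p}_0(α,β)`, with weak derivative `u'`. -/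
def MemW1p0 (p α β : ℝ) (u u' : ℝ → ℝ) : Prop :=
  MemW1pC p α β u u' ∧ u α = 0 ∧ u β = 0

/-- `u ∈ W^{1,p}(α,β)` (interior version: no constraint at endpoints). -/
def MemW1pI (p α β : ℝ) (u u' : ℝ → ℝ) : Prop :=
  IntervalIntegrable u' volume α β ∧
  (∀ s ∈ Set.Ioo α β, ∀ t ∈ Set.Ioo α β, u t = u s + ∫ r in s..t, u' r) ∧
  IntegrableOn (fun t => |u' t| ^ p) (Set.Ioo α β) volume

/-- `λ_p^H(α,β)` for a one-dimensional anisotropy `H`. -/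
def lamH1 (p : ℝ) (H : ℝ → ℝ) (α β : ℝ) : ℝ :=
  sInf { E | ∃ u u', MemW1p0 p α β u u' ∧ (∫ t in Set.Ioo α β, |u t| ^ p) = 1 ∧
    E = ∫ t in Set.Ioo α β, H (u' t) ^ p }

/-- `λ_{1,p}(α,β)`, the principal Dirichlet eigenvalue of the 1d `p`-Laplacian. -/
def lam1 (p α β : ℝ) : ℝ := lamH1 p (fun t => |t|) α β

/-- `λ_p^{a,b}(α,β)`. -/
def lamAB (p a b α β : ℝ) : ℝ := lamH1 p (fun t => a * ppart t + b * npart t) α β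

/-- `λ_p^+(-T,T)`. -/
def lamPlus (p T : ℝ) : ℝ := lamH1 p ppart (-T) T

/-- `φ` is the (normalized positive) principal eigenfunction of the 1d `p`-Laplacian
on `(-T,T)`, with weak derivative `φ'`. -/
def IsPrincipalEigenfunction (p T : ℝ) (φ φ' : ℝ → ℝ) : Prop :=
  MemW1p0 p (-T) T φ φ' ∧ (∀ t ∈ Set.Ioo (-T) T, 0 < φ t) ∧
  (∫ t in Set.Ioo (-T) T, |φ t| ^ p) = 1 ∧
  (∫ t in Set.Ioo (-T) T, |φ' t| ^ p) = lam1 p (-T) T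

/-- The piecewise Sobolev class `W_pw^{1,p,+}(-T,T)`. -/
def MemWpw (p T : ℝ) (u u' : ℝ → ℝ) : Prop :=
  ∃ (m : ℕ) (P : ℕ → ℝ), 0 < m ∧ P 0 = -T ∧ P m = T ∧
    (∀ i < m, P i < P (i + 1)) ∧
    (∀ i < m, MemW1pI p (P i) (P (i + 1)) u u') ∧
    (∃ l₀, Tendsto u (𝓝[>] (-T)) (𝓝 l₀) ∧ l₀ ≤ 0) ∧
    (∃ l₁, Tendsto u (𝓝[<] T) (𝓝 l₁) ∧ 0 ≤ l₁) ∧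
    (∀ i, 0 < i → i < m → ∃ lm lp, Tendsto u (𝓝[<] (P i)) (𝓝 lm) ∧
      Tendsto u (𝓝[>] (P i)) (𝓝 lp) ∧ lp < lm)

/-! ### Two dimensions -/

/-- The Euclidean plane. -/
abbrev V2 := EuclideanSpace ℝ (Fin 2)

/-- The point of `ℝ²` with coordinates `(x, y)`. -/
def mk2 (x y : ℝ) : V2 := (EuclideanSpace.equiv (Fin 2) ℝ).symm ![x, y]

/-- An asymmetric anisotropy: nonnegative, convex and positively 1-homogeneous. -/
def IsAnisotropy (H : V2 → ℝ) : Prop :=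
  (∀ v, 0 ≤ H v) ∧ ConvexOn ℝ Set.univ H ∧ ∀ t : ℝ, 0 < t → ∀ v : V2, H (t • v) = t * H v

/-- A bounded domain of `ℝ²`. -/
def IsBoundedDomain (Ω : Set V2) : Prop :=
  IsOpen Ω ∧ IsConnected Ω ∧ Bornology.IsBounded Ω

/-- Smooth compactly supported test function on `Ω`. -/
def TestFun2 (Ω : Set V2) (φ : V2 → ℝ) : Prop :=
  ContDiff ℝ (⊤ : ℕ∞) φ ∧ HasCompactSupport φ ∧ tsupport φ ⊆ Ω

/-- `u ∈ W^{1,p}_0(Ω)`, with weak gradient `g`: `u` and `g` are `p`-integrable on `Ω`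
and approximable in `W^{1,p}`-norm by smooth functions compactly supported in `Ω`. -/
def MemW1p02 (p : ℝ) (Ω : Set V2) (u : V2 → ℝ) (g : V2 → V2) : Prop :=
  IntegrableOn (fun x => |u x| ^ p) Ω volume ∧
  IntegrableOn (fun x => ‖g x‖ ^ p) Ω volume ∧
  ∃ φ : ℕ → V2 → ℝ, (∀ n, TestFun2 Ω (φ n)) ∧
    Tendsto (fun n => ∫ x in Ω, |u x - φ n x| ^ p) atTop (𝓝 0) ∧
    Tendsto (fun n => ∫ x in Ω, ‖g x - gradient (φ n) x‖ ^ p) atTop (𝓝 0)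

/-- The least anisotropic energy level `λ_p^H(Ω)`. -/
def lamH (p : ℝ) (H : V2 → ℝ) (Ω : Set V2) : ℝ :=
  sInf { E | ∃ u g, MemW1p02 p Ω u g ∧ (∫ x in Ω, |u x| ^ p) = 1 ∧
    E = ∫ x in Ω, H (g x) ^ p }

/-- `λ_p^H(Ω)` is a fundamental frequency of `-Δ_p^H` on `Ω`. -/
def IsFundFreq (p : ℝ) (H : V2 → ℝ) (Ω : Set V2) : Prop :=
  ∃ u g, MemW1p02 p Ω u g ∧ ¬ (∀ᵐ x ∂(volume.restrict Ω), u x = 0) ∧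
    (∀ᵐ x ∂(volume.restrict Ω), DifferentiableAt ℝ H (g x)) ∧
    AEMeasurable (fun x => gradient H (g x)) (volume.restrict Ω) ∧
    ∀ φ gφ, MemW1p02 p Ω φ gφ →
      (∫ x in Ω, H (g x) ^ (p - 1) * ⟪gradient H (g x), gφ x⟫) =
        lamH p H Ω * ∫ x in Ω, |u x| ^ (p - 2) * u x * φ x

/-- The infimum `λ_p^H(Ω)` is attained by a (normalized, hence nonzero) function. -/
def IsAttained (p : ℝ) (H : V2 → ℝ) (Ω : Set V2) : Prop :=
  ∃ u g, MemW1p02 p Ω u g ∧ (∫ x in Ω, |u x| ^ p) = 1 ∧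
    (∫ x in Ω, H (g x) ^ p) = lamH p H Ω

/-- `‖H‖ := max {H v : |v| = 1}`. -/
def normH (H : V2 → ℝ) : ℝ := sSup (H '' Metric.sphere 0 1)

/-- A rotation: a linear isometry with positive determinant. -/
def IsRotation (A : V2 ≃ₗᵢ[ℝ] V2) : Prop :=
  0 < LinearMap.det (A.toLinearEquiv : V2 →ₗ[ℝ] V2)

/-- The kernel of an anisotropy. -/
def kerH (H : V2 → ℝ) : Set V2 := {v | H v = 0}

/-- `S` is a line through the origin. -/
def IsLine (S : Set V2) : Prop := ∃ v : V2, v ≠ 0 ∧ S = {w | ∃ t : ℝ, w = t • v}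

/-- `S` is a closed half-plane bounded by a line through the origin. -/
def IsClosedHalfPlane (S : Set V2) : Prop := ∃ v : V2, v ≠ 0 ∧ S = {w | ⟪v, w⟫ ≤ 0}

/-- Smooth compactly supported test function on an open set `S ⊆ ℝ`. -/
def TestFun1 (S : Set ℝ) (φ : ℝ → ℝ) : Prop :=
  ContDiff ℝ (⊤ : ℕ∞) φ ∧ HasCompactSupport φ ∧ tsupport φ ⊆ S

/-- `v ∈ W^{1,p}_0(S)` for an open set `S ⊆ ℝ`, with weak derivative `v'`. -/
def MemW1p0S (p : ℝ) (S : Set ℝ) (v v' : ℝ → ℝ) : Prop :=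
  IntegrableOn (fun t => |v t| ^ p) S volume ∧
  IntegrableOn (fun t => |v' t| ^ p) S volume ∧
  ∃ φ : ℕ → ℝ → ℝ, (∀ n, TestFun1 S (φ n)) ∧
    Tendsto (fun n => ∫ t in S, |v t - φ n t| ^ p) atTop (𝓝 0) ∧
    Tendsto (fun n => ∫ t in S, |v' t - deriv (φ n) t| ^ p) atTop (𝓝 0)

/-- A bounded domain with Lipschitz (`C^{0,1}`) boundary: near each boundary point, after a
rigid motion, `Ω` is the region above the graph of a Lipschitz function. -/
def IsC01Domain (Ω : Set V2) : Prop :=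
  IsBoundedDomain Ω ∧
  ∀ z ∈ frontier Ω, ∃ (A : V2 ≃ₗᵢ[ℝ] V2) (r K : ℝ) (f : ℝ → ℝ), 0 < r ∧ 0 ≤ K ∧
    LipschitzWith (Real.toNNReal K) f ∧
    ∀ v ∈ Metric.ball z r, (v ∈ Ω ↔ f ((A (v - z)) 0) < (A (v - z)) 1)

/-- The supremal length of a vertical open segment contained in `D`. -/
def vertWidth (D : Set V2) : ℝ :=
  sSup {l : ℝ | ∃ x c : ℝ, ∀ y ∈ Set.Ioo c (c + l), mk2 x y ∈ D}

/-- The width function `L_θ` of `Ω` in direction `θ`. -/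
def widthFn (Ω : Set V2) (θ : ℝ) : ℝ :=
  sSup {l : ℝ | ∃ (v : V2) (t0 : ℝ),
    ∀ t ∈ Set.Ioo t0 (t0 + l), v + t • mk2 (Real.cos θ) (Real.sin θ) ∈ Ω}

/-- The variational `p`-capacity of `K` relative to `B`. -/
def pCap (p : ℝ) (K B : Set V2) : ℝ :=
  sInf { E | ∃ φ : V2 → ℝ, ContDiff ℝ (⊤ : ℕ∞) φ ∧ HasCompactSupport φ ∧ tsupport φ ⊆ B ∧
    (∀ x ∈ K, 1 ≤ φ x) ∧ E = ∫ x, ‖gradient φ x‖ ^ p }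

/-- The Wiener criterion for the `p`-Laplacian at a boundary point `z`:
the Wiener integral diverges. -/
def WienerRegularAt (p : ℝ) (Ω : Set V2) (z : V2) : Prop :=
  ¬ IntegrableOn (fun t =>
      (pCap p (Metric.closedBall z t \ Ω) (Metric.ball z (2 * t)) /
        pCap p (Metric.closedBall z t) (Metric.ball z (2 * t))) ^ (1 / (p - 1)) / t)
    (Set.Ioo (0 : ℝ) 1) volume

/-- The optimal lower spectral constant `Λ^min(Ω)`. -/
def LambdaMin (p : ℝ) (Ω : Set V2) : ℝ :=
  sInf {lam : ℝ | ∃ H : V2 → ℝ, IsAnisotropy H ∧ normH H = 1 ∧ IsFundFreq p H Ω ∧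
    lam = lamH p H Ω}

end

noncomputable section

lemma ppart_nonneg (t : ℝ) : 0 ≤ ppart t := le_max_right _ _

lemma le_ppart (t : ℝ) : t ≤ ppart t := le_max_left _ _

lemma ppart_le_abs (t : ℝ) : ppart t ≤ |t| := max_le (le_abs_self t) (abs_nonneg t)

lemma ppart_mul {c : ℝ} (hc : 0 ≤ c) (t : ℝ) : ppart (c * t) = c * ppart t := by
  simp [ppart, mul_max_of_nonneg _ _ hc]

lemma measurable_ppart : Measurable ppart := measurable_id.max measurable_const

lemma MemW1pC.const_mul {p α β : ℝ} {u u' : ℝ → ℝ} (h : MemW1pC p α β u u') (c : ℝ) :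
    MemW1pC p α β (fun t => c * u t) (fun t => c * u' t) := by
  obtain ⟨h1, h2, h3⟩ := h
  refine ⟨h1.const_mul c, fun t ht => ?_, ?_⟩
  · simp only [intervalIntegral.integral_const_mul]
    rw [h2 t ht]; ring
  · refine (h3.const_mul (|c| ^ p)).congr (ae_of_all _ fun t => ?_)
    simp only [abs_mul]
    rw [Real.mul_rpow (abs_nonneg _) (abs_nonneg _)]

lemma lamH1_mul_le {p α β : ℝ} {H : ℝ → ℝ} (hp : 1 < p) (hH : ∀ t, 0 ≤ H t)
    (hmul : ∀ c : ℝ, 0 < c → ∀ t, H (c * t) = c * H t) {v v' : ℝ → ℝ}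
    (hv : MemW1p0 p α β v v') :
    lamH1 p H α β * ∫ t in Ioo α β, |v t| ^ p ≤ ∫ t in Ioo α β, H (v' t) ^ p := by
  have hE : 0 ≤ ∫ t in Ioo α β, H (v' t) ^ p :=
    integral_nonneg fun t => Real.rpow_nonneg (hH _) _
  have hI : 0 ≤ ∫ t in Ioo α β, |v t| ^ p :=
    integral_nonneg fun t => Real.rpow_nonneg (abs_nonneg _) _
  rcases hI.eq_or_lt with h0 | hpos
  · rwa [← h0, mul_zero]
  set I := ∫ t in Ioo α β, |v t| ^ p with hIdef
  set c : ℝ := I ^ (-(1 / p)) with hc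
  have hc0 : 0 < c := Real.rpow_pos_of_pos hpos _
  have hcp : c ^ p = I⁻¹ := by
    rw [hc, ← Real.rpow_mul hpos.le, ← Real.rpow_neg_one]
    congr 1
    field_simp
  have hle : lamH1 p H α β ≤ c ^ p * ∫ t in Ioo α β, H (v' t) ^ p := by
    refine csInf_le ⟨0, ?_⟩ ⟨fun t => c * v t, fun t => c * v' t,
      ⟨hv.1.const_mul c, by simp [hv.2.1], by simp [hv.2.2]⟩, ?_, ?_⟩
    · rintro E ⟨w, w', -, -, rfl⟩
      exact integral_nonneg fun t => Real.rpow_nonneg (hH _) _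
    · simp only [abs_mul, abs_of_pos hc0]
      simp_rw [Real.mul_rpow hc0.le (abs_nonneg _)]
      rw [integral_const_mul, hcp, ← hIdef, inv_mul_cancel₀ hpos.ne']
    · simp_rw [hmul c hc0, Real.mul_rpow hc0.le (hH _)]
      rw [integral_const_mul]
  calc lamH1 p H α β * I ≤ (c ^ p * ∫ t in Ioo α β, H (v' t) ^ p) * I :=
        mul_le_mul_of_nonneg_right hle hI
    _ = ∫ t in Ioo α β, H (v' t) ^ p := by rw [hcp]; field_simp

lemma lam1_mul_le {p α β : ℝ} (hp : 1 < p) {v v' : ℝ → ℝ} (hv : MemW1p0 p α β v v') :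
    lam1 p α β * ∫ t in Ioo α β, |v t| ^ p ≤ ∫ t in Ioo α β, |v' t| ^ p :=
  lamH1_mul_le hp abs_nonneg (fun c hc t => by rw [abs_mul, abs_of_pos hc]) hv

lemma lamPlus_mul_le {p T : ℝ} (hp : 1 < p) {v v' : ℝ → ℝ} (hv : MemW1p0 p (-T) T v v') :
    lamPlus p T * ∫ t in Ioo (-T) T, |v t| ^ p ≤ ∫ t in Ioo (-T) T, ppart (v' t) ^ p :=
  lamH1_mul_le hp ppart_nonneg (fun _ hc t => ppart_mul hc.le t) hv

lemma strictConvexOn_abs_rpow {p : ℝ} (hp : 1 < p) :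
    StrictConvexOn ℝ univ (fun x : ℝ => |x| ^ p) := by
  refine ⟨convex_univ, fun x _ y _ hxy a b ha hb hab => ?_⟩
  simp only [smul_eq_mul]
  by_cases h : |x| = |y|
  · have hy : y = -x := by
      rcases abs_eq_abs.1 h with h | h
      · exact absurd h hxy
      · rw [h]; ring
    have hx : 0 < |x| := by
      rw [abs_pos]; rintro rfl; simp [hy] at hxy
    have hlt : |a * x + b * y| < |x| := by
      have : a * x + b * y = (a - b) * x := by rw [hy]; ring
      rw [this, abs_mul]
      have : |a - b| < 1 := abs_lt.2 ⟨by linarith, by linarith⟩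
      nlinarith
    calc |a * x + b * y| ^ p < |x| ^ p := Real.rpow_lt_rpow (abs_nonneg _) hlt (by linarith)
      _ = a * |x| ^ p + b * |y| ^ p := by rw [← h, ← add_mul, hab, one_mul]
  · calc |a * x + b * y| ^ p ≤ (a * |x| + b * |y|) ^ p := by
          refine Real.rpow_le_rpow (abs_nonneg _) ?_ (by linarith)
          calc |a * x + b * y| ≤ |a * x| + |b * y| := abs_add_le _ _
            _ = _ := by rw [abs_mul, abs_mul, abs_of_pos ha, abs_of_pos hb]
      _ < _ := (strictConvexOn_rpow hp).2 (abs_nonneg x) (abs_nonneg y) h ha hb hab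

/-- Pointwise form of hidden convexity: `d` is the derivative of `(x ^ p + y ^ p) ^ (1 / p)` when
`x` and `y` have derivatives `a` and `b`. -/
lemma hidden_convexity {p x y a b w d : ℝ} (hp : 1 < p) (hx : 0 < x) (hy : 0 ≤ y) (hw : 0 < w)
    (hwp : w ^ p = x ^ p + y ^ p) (hd : d * w ^ (p - 1) = a * x ^ (p - 1) + b * y ^ (p - 1)) :
    |d| ^ p ≤ |a| ^ p + |b| ^ p ∧ (|d| ^ p = |a| ^ p + |b| ^ p → 0 < y → b * x = a * y) := by
  have hp0 : 0 < p := by linarith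
  rcases hy.eq_or_lt with rfl | hy
  · rw [Real.zero_rpow hp0.ne', add_zero] at hwp
    have hwx : w = x := Real.rpow_left_injOn hp0.ne' hw.le hx.le hwp
    rw [Real.zero_rpow (by linarith), mul_zero, add_zero, hwx] at hd
    have : d = a := mul_right_cancel₀ (Real.rpow_pos_of_pos hx _).ne' hd
    exact ⟨by rw [this]; linarith [Real.rpow_nonneg (abs_nonneg b) p],
      fun _ h => absurd h (lt_irrefl _)⟩
  have key : ∀ z : ℝ, 0 < z → z ^ p = z ^ (p - 1) * z := fun z hz => by
    rw [Real.rpow_sub_one hz.ne']; field_simp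
  have hxp := Real.rpow_pos_of_pos hx p
  have hyp := Real.rpow_pos_of_pos hy p
  have hwp' := Real.rpow_pos_of_pos hw p
  have hsum : x ^ p / w ^ p + y ^ p / w ^ p = 1 := by rw [← add_div, ← hwp, div_self hwp'.ne']
  have hcomb : d / w = x ^ p / w ^ p * (a / x) + y ^ p / w ^ p * (b / y) := by
    have h1 := Real.rpow_pos_of_pos hw (p - 1)
    rw [key x hx, key y hy, key w hw]
    field_simp
    linarith
  have hdiv : ∀ s z : ℝ, 0 < z → z ^ p * |s / z| ^ p = |s| ^ p := fun s z hz => by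
    rw [abs_div, abs_of_pos hz, Real.div_rpow (abs_nonneg _) hz.le]
    field_simp [(Real.rpow_pos_of_pos hz p).ne']
  have hR : |a| ^ p + |b| ^ p =
      w ^ p * (x ^ p / w ^ p * |a / x| ^ p + y ^ p / w ^ p * |b / y| ^ p) := by
    rw [← hdiv a x hx, ← hdiv b y hy]
    field_simp
  have hL : |d| ^ p = w ^ p * |d / w| ^ p := (hdiv d w hw).symm
  rw [hR, hL, hcomb]
  have hconv := strictConvexOn_abs_rpow hp
  refine ⟨mul_le_mul_of_nonneg_left ?_ hwp'.le, fun h _ => ?_⟩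
  · exact hconv.convexOn.2 (mem_univ (a / x)) (mem_univ (b / y)) (by positivity) (by positivity)
      hsum
  · by_contra hne
    have hne' : a / x ≠ b / y := by
      intro h'
      rw [div_eq_div_iff hx.ne' hy.ne'] at h'
      exact hne h'.symm
    have := hconv.2 (mem_univ (a / x)) (mem_univ (b / y)) hne'
      (div_pos hxp hwp') (div_pos hyp hwp') hsum
    simp only [smul_eq_mul] at this
    exact (mul_lt_mul_of_pos_left this hwp').ne h

lemma absolutelyContinuousOnInterval_of_abs_sub_le {w k : ℝ → ℝ} {a b : ℝ} (hab : a ≤ b)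
    (hk : IntervalIntegrable k volume a b)
    (h : ∀ s ∈ Icc a b, ∀ t ∈ Icc a b, s ≤ t → |w t - w s| ≤ ∫ r in s..t, k r) :
    AbsolutelyContinuousOnInterval w a b := by
  have hF := hk.absolutelyContinuousOnInterval_intervalIntegral (c := a) left_mem_uIcc
  have hdist : ∀ s ∈ Icc a b, ∀ t ∈ Icc a b,
      dist (w s) (w t) ≤ dist (∫ r in a..s, k r) (∫ r in a..t, k r) := by
    have hint : ∀ s ∈ Icc a b, IntervalIntegrable k volume a s := fun s hs =>
      hk.mono_set (by rw [uIcc_of_le hab, uIcc_of_le hs.1]; exact Icc_subset_Icc_right hs.2)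
    have aux : ∀ s ∈ Icc a b, ∀ t ∈ Icc a b, s ≤ t →
        dist (w s) (w t) ≤ dist (∫ r in a..s, k r) (∫ r in a..t, k r) := by
      intro s hs t ht hst
      rw [dist_comm, Real.dist_eq, dist_comm, Real.dist_eq,
        intervalIntegral.integral_interval_sub_left (hint t ht) (hint s hs)]
      exact (h s hs t ht hst).trans (le_abs_self _)
    intro s hs t ht
    rcases le_total s t with hst | hst
    · exact aux s hs t ht hst
    · rw [dist_comm, dist_comm (∫ r in a..s, k r)]
      exact aux t ht s hs hst
  refine squeeze_zero' (Eventually.of_forall fun E => Finset.sum_nonneg fun i _ => dist_nonneg)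
    ?_ hF
  refine Eventually.filter_mono inf_le_right (eventually_principal.2 fun E hE => ?_)
  refine Finset.sum_le_sum fun i hi => ?_
  have := hE.1 i hi
  rw [uIcc_of_le hab] at this
  exact hdist _ this.1 _ this.2

lemma IntervalIntegrable.mono_Icc {f : ℝ → ℝ} {a b s t : ℝ} (hf : IntervalIntegrable f volume a b)
    (hs : s ∈ Icc a b) (ht : t ∈ Icc a b) : IntervalIntegrable f volume s t := by
  refine hf.mono_set ?_
  rw [uIcc_of_le (hs.1.trans hs.2)]
  exact ordConnected_Icc.uIcc_subset hs ht

lemma MemW1pC.sub_eq {p α β : ℝ} {u u' : ℝ → ℝ} (h : MemW1pC p α β u u') {s t : ℝ}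
    (hs : s ∈ Icc α β) (ht : t ∈ Icc α β) : u t - u s = ∫ r in s..t, u' r := by
  have hα : α ∈ Icc α β := left_mem_Icc.2 (hs.1.trans hs.2)
  rw [h.2.1 t ht, h.2.1 s hs, ← intervalIntegral.integral_interval_sub_left
    (h.1.mono_Icc hα ht) (h.1.mono_Icc hα hs)]
  ring

lemma MemW1pC.abs_sub_le {p α β : ℝ} {u u' : ℝ → ℝ} (h : MemW1pC p α β u u') {s t : ℝ}
    (hs : s ∈ Icc α β) (ht : t ∈ Icc α β) (hst : s ≤ t) : |u t - u s| ≤ ∫ r in s..t, |u' r| := by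
  rw [h.sub_eq hs ht]
  exact intervalIntegral.abs_integral_le_integral_abs hst

lemma MemW1pC.absolutelyContinuousOnInterval {p α β : ℝ} {u u' : ℝ → ℝ} (hαβ : α ≤ β)
    (h : MemW1pC p α β u u') : AbsolutelyContinuousOnInterval u α β :=
  absolutelyContinuousOnInterval_of_abs_sub_le hαβ h.1.abs
    fun _ hs _ ht hst => h.abs_sub_le hs ht hst

lemma MemW1pC.continuousOn {p α β : ℝ} {u u' : ℝ → ℝ} (hαβ : α ≤ β)
    (h : MemW1pC p α β u u') : ContinuousOn u (Icc α β) := by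
  simpa [uIcc_of_le hαβ] using (h.absolutelyContinuousOnInterval hαβ).continuousOn

lemma MemW1pC.ae_hasDerivAt {p α β : ℝ} {u u' : ℝ → ℝ} (h : MemW1pC p α β u u') :
    ∀ᵐ x, x ∈ Ioo α β → HasDerivAt u (u' x) x := by
  filter_upwards [h.1.ae_hasDerivAt_integral] with x hx hxm
  have hαβ : α ≤ β := (hxm.1.trans hxm.2).le
  have := (hx (by rw [uIcc_of_le hαβ]; exact Ioo_subset_Icc_self hxm) α left_mem_uIcc).const_add
    (u α)
  refine this.congr_of_eventuallyEq ?_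
  filter_upwards [Ioo_mem_nhds hxm.1 hxm.2] with t ht
  exact h.2.1 t (Ioo_subset_Icc_self ht)

lemma rpow_add_rpow_abs_sub_le {p x₁ y₁ x₂ y₂ : ℝ} (hp : 1 < p) (hx₁ : 0 ≤ x₁) (hy₁ : 0 ≤ y₁)
    (hx₂ : 0 ≤ x₂) (hy₂ : 0 ≤ y₂) :
    |(x₁ ^ p + y₁ ^ p) ^ (1 / p) - (x₂ ^ p + y₂ ^ p) ^ (1 / p)| ≤ |x₁ - x₂| + |y₁ - y₂| := by
  have aux : ∀ {a b c d : ℝ}, 0 ≤ a → 0 ≤ b → 0 ≤ c → 0 ≤ d →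
      (a ^ p + b ^ p) ^ (1 / p) ≤ (c ^ p + d ^ p) ^ (1 / p) + (|a - c| + |b - d|) := by
    intro a b c d ha hb hc hd
    have hp0 : 0 < p := by linarith
    have h1 := Real.Lp_add_le_of_nonneg (Finset.univ : Finset (Fin 2)) (f := ![c, d])
      (g := ![|a - c|, |b - d|]) hp.le (by simp [Fin.forall_fin_two, hc, hd])
      (by simp [Fin.forall_fin_two])
    simp only [Fin.sum_univ_two, Matrix.cons_val_zero, Matrix.cons_val_one] at h1
    have h2 := Real.rpow_add_rpow_le_add (abs_nonneg (a - c)) (abs_nonneg (b - d)) hp.le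
    have h3 : (a ^ p + b ^ p) ^ (1 / p) ≤
        ((c + |a - c|) ^ p + (d + |b - d|) ^ p) ^ (1 / p) := by
      have := le_abs_self (a - c)
      have := le_abs_self (b - d)
      gcongr <;> linarith
    linarith
  rw [abs_le]
  have h1 := aux hx₁ hy₁ hx₂ hy₂
  have h2 := aux hx₂ hy₂ hx₁ hy₁
  rw [abs_sub_comm x₂, abs_sub_comm y₂] at h2
  constructor <;> linarith

lemma hasDerivAt_rpow_add_rpow {p a b x : ℝ} {f g : ℝ → ℝ} (hp : 1 < p) (hf : HasDerivAt f a x)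
    (hg : HasDerivAt g b x) (hfx : 0 < f x) (hgx : 0 ≤ g x) :
    ∃ d, HasDerivAt (fun t => (f t ^ p + g t ^ p) ^ (1 / p)) d x ∧
      d * ((f x ^ p + g x ^ p) ^ (1 / p)) ^ (p - 1) =
        a * f x ^ (p - 1) + b * g x ^ (p - 1) := by
  have hp0 : 0 < p := by linarith
  have hS : 0 < f x ^ p + g x ^ p :=
    add_pos_of_pos_of_nonneg (Real.rpow_pos_of_pos hfx p) (Real.rpow_nonneg hgx p)
  refine ⟨_, ((hf.rpow_const (p := p) (Or.inr hp.le)).add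
    (hg.rpow_const (p := p) (Or.inr hp.le))).rpow_const (p := 1 / p) (Or.inl hS.ne'), ?_⟩
  simp only [Pi.add_apply]
  have : (f x ^ p + g x ^ p) ^ (1 / p - 1) * ((f x ^ p + g x ^ p) ^ (1 / p)) ^ (p - 1) = 1 := by
    rw [← Real.rpow_mul hS.le, ← Real.rpow_add hS]
    have : 1 / p - 1 + 1 / p * (p - 1) = 0 := by field_simp; ring
    rw [this, Real.rpow_zero]
  rw [mul_assoc, this]
  field_simp

lemma MemW1pC.integrableOn_abs_rpow {p α β : ℝ} {u u' : ℝ → ℝ} (hp : 1 < p) (hαβ : α ≤ β)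
    (h : MemW1pC p α β u u') : IntegrableOn (fun t => |u t| ^ p) (Ioo α β) volume := by
  have : ContinuousOn (fun t => |u t| ^ p) (Icc α β) :=
    (h.continuousOn hαβ).abs.rpow_const fun _ _ => Or.inr (by linarith)
  exact (this.integrableOn_compact isCompact_Icc).mono_set Ioo_subset_Icc_self

/-- If the derivatives of `φ > 0` and `v` are a.e. proportional to `φ` and `v`, then `v` is a
multiple of `φ`. -/
lemma eq_const_mul_of_ae_deriv_mul_eq {p α β : ℝ} {φ φ' v v' : ℝ → ℝ} (hαβ : α < β)
    (hφ : MemW1pC p α β φ φ') (hv : MemW1pC p α β v v') (hpos : ∀ t ∈ Ioo α β, 0 < φ t)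
    (hprop : ∀ᵐ x, x ∈ Ioo α β → v' x * φ x = φ' x * v x) :
    ∃ c, ∀ t ∈ Ioo α β, v t = c * φ t := by
  set m := (α + β) / 2 with hm
  have hmI : m ∈ Ioo α β := ⟨by rw [hm]; linarith, by rw [hm]; linarith⟩
  refine ⟨v m / φ m, fun t ht => ?_⟩
  set a := min m t
  set b := max m t
  have hab : a ≤ b := min_le_max
  have ha : a ∈ Ioo α β := ⟨lt_min hmI.1 ht.1, (min_le_left _ _).trans_lt hmI.2⟩
  have hb : b ∈ Ioo α β := ⟨hmI.1.trans_le (le_max_left _ _), max_lt hmI.2 ht.2⟩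
  have hsub : Icc a b ⊆ Ioo α β := fun x hx => ⟨ha.1.trans_le hx.1, hx.2.trans_lt hb.2⟩
  have hsub' : Icc a b ⊆ Icc α β := hsub.trans Ioo_subset_Icc_self
  obtain ⟨z, hz, hzmin⟩ := isCompact_Icc.exists_isMinOn (nonempty_Icc.2 hab)
    ((hφ.continuousOn hαβ.le).mono hsub')
  have hz0 := hpos z (hsub hz)
  have hinv : AbsolutelyContinuousOnInterval (fun x => (φ x)⁻¹) a b := by
    refine absolutelyContinuousOnInterval_of_abs_sub_le hab
      (k := fun r => |φ' r| * (φ z ^ 2)⁻¹)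
      ((hφ.1.abs.mul_const _).mono_Icc (hsub' (left_mem_Icc.2 hab)) (hsub' (right_mem_Icc.2 hab)))
      fun s hs r hr hsr => ?_
    rw [intervalIntegral.integral_mul_const]
    have h1 := hφ.abs_sub_le (hsub' hs) (hsub' hr) hsr
    have hs0 := hpos s (hsub hs)
    have hr0 := hpos r (hsub hr)
    have h2 : (φ r)⁻¹ - (φ s)⁻¹ = (φ s - φ r) * (φ s * φ r)⁻¹ := by field_simp
    rw [h2, abs_mul, abs_sub_comm, abs_of_pos (inv_pos.2 (mul_pos hs0 hr0))]
    refine mul_le_mul h1 ?_ (by positivity) ((abs_nonneg _).trans h1)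
    rw [sq]
    exact inv_anti₀ (by positivity) (mul_le_mul (hzmin hs) (hzmin hr) hz0.le hs0.le)
  have hac : AbsolutelyContinuousOnInterval v a b :=
    (hv.absolutelyContinuousOnInterval hαβ.le).mono
      (by rw [uIcc_of_le hab, uIcc_of_le hαβ.le]; exact hsub')
  obtain ⟨C, hC⟩ := (hac.mul hinv).const_of_ae_hasDerivAt_zero (by
    filter_upwards [hφ.ae_hasDerivAt, hv.ae_hasDerivAt, hprop] with x h1 h2 h3 hx
    rw [uIcc_of_le hab] at hx
    have hx' := hsub hx
    have hx0 := hpos x hx'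
    convert! (h2 hx').mul ((h1 hx').inv hx0.ne') using 1
    have := h3 hx'
    simp only [Pi.inv_apply]
    field_simp
    linarith)
  have h1 := hC m (by rw [uIcc_of_le hab]; exact ⟨min_le_left _ _, le_max_left _ _⟩)
  have h2 := hC t (by rw [uIcc_of_le hab]; exact ⟨min_le_right _ _, le_max_right _ _⟩)
  simp only [Pi.mul_apply] at h1 h2
  rw [div_eq_mul_inv, h1, ← h2, mul_assoc, inv_mul_cancel₀ (hpos t ht).ne', mul_one]

/-- Nonnegative minimizers of the Rayleigh quotient are multiples of the principal
eigenfunction. -/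
lemma IsPrincipalEigenfunction.eq_const_mul {p T : ℝ} (hp : 1 < p) (hT : 0 < T)
    {φ φ' v v' : ℝ → ℝ} (hφ : IsPrincipalEigenfunction p T φ φ')
    (hv : MemW1p0 p (-T) T v v') (hv0 : ∀ t ∈ Icc (-T) T, 0 ≤ v t)
    (hE : ∫ t in Ioo (-T) T, |v' t| ^ p ≤ lam1 p (-T) T * ∫ t in Ioo (-T) T, |v t| ^ p) :
    ∃ c, 0 ≤ c ∧ ∀ t ∈ Icc (-T) T, v t = c * φ t := by
  obtain ⟨hφ1, hφpos, hφn, hφE⟩ := hφ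
  have hp0 : 0 < p := by linarith
  have hTT : -T ≤ T := by linarith
  have hIoo : Ioo (-T) T ⊆ Icc (-T) T := Ioo_subset_Icc_self
  have hφ0 : ∀ t ∈ Icc (-T) T, 0 ≤ φ t := by
    intro t ht
    rcases ht.1.eq_or_lt with h | h
    · rw [← h, hφ1.2.1]
    rcases ht.2.eq_or_lt with h' | h'
    · rw [h', hφ1.2.2]
    · exact (hφpos t ⟨h, h'⟩).le
  set w : ℝ → ℝ := fun t => (φ t ^ p + v t ^ p) ^ (1 / p) with hw
  have hwac : AbsolutelyContinuousOnInterval w (-T) T := by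
    refine absolutelyContinuousOnInterval_of_abs_sub_le hTT (hφ1.1.1.abs.add hv.1.1.abs)
      fun s hs t ht hst => ?_
    rw [intervalIntegral.integral_add (hφ1.1.1.mono_Icc hs ht).abs (hv.1.1.mono_Icc hs ht).abs]
    exact (rpow_add_rpow_abs_sub_le hp (hφ0 t ht) (hv0 t ht) (hφ0 s hs) (hv0 s hs)).trans
      (add_le_add (hφ1.1.abs_sub_le hs ht hst) (hv.1.abs_sub_le hs ht hst))
  have hwp : ∀ t ∈ Ioo (-T) T, 0 < w t ∧ w t ^ p = φ t ^ p + v t ^ p := by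
    intro t ht
    have : 0 < φ t ^ p + v t ^ p := add_pos_of_pos_of_nonneg
      (Real.rpow_pos_of_pos (hφpos t ht) p) (Real.rpow_nonneg (hv0 t (hIoo ht)) p)
    refine ⟨Real.rpow_pos_of_pos this _, ?_⟩
    rw [hw, ← Real.rpow_mul this.le, one_div_mul_cancel hp0.ne', Real.rpow_one]
  have hpt : ∀ᵐ x, x ∈ Ioo (-T) T → |deriv w x| ^ p ≤ |φ' x| ^ p + |v' x| ^ p ∧
      (|deriv w x| ^ p = |φ' x| ^ p + |v' x| ^ p → v' x * φ x = φ' x * v x) := by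
    filter_upwards [hφ1.1.ae_hasDerivAt, hv.1.ae_hasDerivAt] with x h1 h2 hx
    obtain ⟨d, hd, hd'⟩ := hasDerivAt_rpow_add_rpow hp (h1 hx) (h2 hx) (hφpos x hx)
      (hv0 x (hIoo hx))
    obtain ⟨hle, heq⟩ := hidden_convexity hp (hφpos x hx) (hv0 x (hIoo hx)) (hwp x hx).1
      (hwp x hx).2 hd'
    rw [hd.deriv]
    refine ⟨hle, fun h => ?_⟩
    rcases (hv0 x (hIoo hx)).eq_or_lt with h0 | h0
    · have hmin : IsLocalMin v x := by
        filter_upwards [Ioo_mem_nhds hx.1 hx.2] with t ht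
        rw [← h0]
        exact hv0 t (hIoo ht)
      rw [hmin.hasDerivAt_eq_zero (h2 hx), ← h0]
      simp
    · exact heq h h0
  have hint : IntegrableOn (fun t => |φ' t| ^ p + |v' t| ^ p) (Ioo (-T) T) :=
    hφ1.1.2.2.add hv.1.2.2
  have hpt' := (ae_restrict_iff' (μ := volume) measurableSet_Ioo).2 hpt
  have hwint : IntegrableOn (fun t => |deriv w t| ^ p) (Ioo (-T) T) := by
    refine hint.mono' ((measurable_deriv w).abs.pow_const p).aestronglyMeasurable ?_
    filter_upwards [hpt'] with x hx
    rw [Real.norm_of_nonneg (Real.rpow_nonneg (abs_nonneg _) _)]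
    exact hx.1
  have hwmem : MemW1p0 p (-T) T w (deriv w) := by
    refine ⟨⟨hwac.intervalIntegrable_deriv, fun t ht => ?_, hwint⟩, ?_, ?_⟩
    · have := (hwac.mono (c := -T) (d := t) (by
        rw [uIcc_of_le hTT, uIcc_of_le ht.1]
        exact Icc_subset_Icc_right ht.2)).integral_deriv_eq_sub
      rw [this]; ring
    · simp [hw, hφ1.2.1, hv.2.1, hp0.ne']
    · simp [hw, hφ1.2.2, hv.2.2, hp0.ne']
  have hwn : ∫ t in Ioo (-T) T, |w t| ^ p =
      (∫ t in Ioo (-T) T, |φ t| ^ p) + ∫ t in Ioo (-T) T, |v t| ^ p := by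
    rw [← integral_add (hφ1.1.integrableOn_abs_rpow hp hTT) (hv.1.integrableOn_abs_rpow hp hTT)]
    refine setIntegral_congr_fun measurableSet_Ioo fun t ht => ?_
    rw [abs_of_pos (hwp t ht).1, (hwp t ht).2, abs_of_pos (hφpos t ht),
      abs_of_nonneg (hv0 t (hIoo ht))]
  have hkey := lam1_mul_le hp hwmem
  rw [hwn, hφn, mul_add, mul_one] at hkey
  have hdiff : ∫ t in Ioo (-T) T, (|φ' t| ^ p + |v' t| ^ p - |deriv w t| ^ p) ≤ 0 := by
    rw [integral_sub hint hwint, integral_add hφ1.1.2.2 hv.1.2.2, hφE]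
    linarith
  have hnn : 0 ≤ᵐ[volume.restrict (Ioo (-T) T)]
      fun t => |φ' t| ^ p + |v' t| ^ p - |deriv w t| ^ p := by
    filter_upwards [hpt'] with x hx
    exact sub_nonneg.2 hx.1
  have hzero := (integral_eq_zero_iff_of_nonneg_ae hnn (hint.sub hwint)).1
    (le_antisymm hdiff (integral_nonneg_of_ae hnn))
  have hprop : ∀ᵐ x ∂(volume.restrict (Ioo (-T) T)), v' x * φ x = φ' x * v x := by
    filter_upwards [hpt', hzero] with x hx hx0
    exact hx.2 (sub_eq_zero.1 hx0).symm
  obtain ⟨c, hc⟩ := eq_const_mul_of_ae_deriv_mul_eq (by linarith) hφ1.1 hv.1 hφpos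
    ((ae_restrict_iff' measurableSet_Ioo).1 hprop)
  refine ⟨c, ?_, fun t ht => ?_⟩
  · have h0 : (0 : ℝ) ∈ Ioo (-T) T := ⟨by linarith, hT⟩
    by_contra hneg
    have := hv0 0 (hIoo h0)
    rw [hc 0 h0] at this
    nlinarith [hφpos 0 h0]
  · rcases ht.1.eq_or_lt with h | h
    · rw [← h, hφ1.2.1, hv.2.1, mul_zero]
    rcases ht.2.eq_or_lt with h' | h'
    · rw [h', hφ1.2.2, hv.2.2, mul_zero]
    · exact hc t ⟨h, h'⟩

lemma setIntegral_Ioo_eq_intervalIntegral {a b : ℝ} (hab : a ≤ b) (f : ℝ → ℝ) :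
    ∫ t in Ioo a b, f t = ∫ t in a..b, f t := by
  rw [intervalIntegral.integral_of_le hab, integral_Ioc_eq_integral_Ioo]

lemma IntervalIntegrable.comp_affine {f : ℝ → ℝ} {a b c d : ℝ} (hc : c ≠ 0)
    (h : IntervalIntegrable f volume (c * a + d) (c * b + d)) :
    IntervalIntegrable (fun x => f (c * x + d)) volume a b := by
  have := (h.comp_add_right d).comp_mul_left (c := c)
  simpa [hc] using this

lemma affine_mem_Icc {A B a b c d t : ℝ} (ha : c * a + d ∈ Icc A B) (hb : c * b + d ∈ Icc A B)
    (ht : t ∈ Icc a b) : c * t + d ∈ Icc A B := by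
  have h1 := ht.1
  have h2 := ht.2
  rcases le_total 0 c with hc | hc
  · exact ⟨by nlinarith [ha.1], by nlinarith [hb.2]⟩
  · exact ⟨by nlinarith [hb.1], by nlinarith [ha.2]⟩

lemma MemW1pC.intervalIntegrable_rpow {p α β : ℝ} {u u' : ℝ → ℝ} (hαβ : α ≤ β)
    (h : MemW1pC p α β u u') : IntervalIntegrable (fun t => |u' t| ^ p) volume α β :=
  (intervalIntegrable_iff_integrableOn_Ioo_of_le hαβ).2 h.2.2

lemma MemW1pC.comp_affine {p A B a b c d : ℝ} {u u' : ℝ → ℝ} (h : MemW1pC p A B u u')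
    (hc : c ≠ 0) (hab : a ≤ b) (ha : c * a + d ∈ Icc A B) (hb : c * b + d ∈ Icc A B) :
    MemW1pC p a b (fun t => u (c * t + d)) (fun t => c * u' (c * t + d)) := by
  have hAB : A ≤ B := ha.1.trans ha.2
  refine ⟨((h.1.mono_Icc ha hb).comp_affine hc).const_mul c, fun t ht => ?_, ?_⟩
  · have := h.sub_eq ha (affine_mem_Icc ha hb ht)
    simp only [intervalIntegral.integral_const_mul]
    rw [intervalIntegral.integral_comp_mul_add u' hc, ← this, smul_eq_mul, mul_inv_cancel_left₀ hc]
    ring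
  · rw [← intervalIntegrable_iff_integrableOn_Ioo_of_le hab]
    have := (((h.intervalIntegrable_rpow hAB).mono_Icc ha hb).comp_affine hc).const_mul (|c| ^ p)
    refine this.congr fun t _ => ?_
    simp only [abs_mul]
    rw [Real.mul_rpow (abs_nonneg _) (abs_nonneg _)]

lemma IntervalIntegrable.ite {f g : ℝ → ℝ} {a b c : ℝ} (hab : a ≤ b) (hbc : b ≤ c)
    (hf : IntervalIntegrable f volume a b) (hg : IntervalIntegrable g volume b c) :
    IntervalIntegrable (fun t => if t ≤ b then f t else g t) volume a b ∧
      IntervalIntegrable (fun t => if t ≤ b then f t else g t) volume b c := by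
  constructor
  · refine hf.congr fun t ht => ?_
    rw [uIoc_of_le hab] at ht
    simp [ht.2]
  · refine hg.congr fun t ht => ?_
    rw [uIoc_of_le hbc] at ht
    simp [ht.1]

lemma intervalIntegral_ite {f g : ℝ → ℝ} {a b c : ℝ} (hab : a ≤ b) (hbc : b ≤ c)
    (hf : IntervalIntegrable f volume a b) (hg : IntervalIntegrable g volume b c) :
    ∫ t in a..c, (if t ≤ b then f t else g t) = (∫ t in a..b, f t) + ∫ t in b..c, g t := by
  obtain ⟨h1, h2⟩ := hf.ite hab hbc hg
  rw [← intervalIntegral.integral_add_adjacent_intervals h1 h2]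
  congr 1
  · refine intervalIntegral.integral_congr_ae (ae_of_all _ fun t ht => ?_)
    rw [uIoc_of_le hab] at ht
    simp [ht.2]
  · refine intervalIntegral.integral_congr_ae (ae_of_all _ fun t ht => ?_)
    rw [uIoc_of_le hbc] at ht
    simp [ht.1]

lemma MemW1pC.glue {p a b c : ℝ} {u u' v v' : ℝ → ℝ} (hab : a ≤ b) (hbc : b ≤ c)
    (hu : MemW1pC p a b u u') (hv : MemW1pC p b c v v') (hb : u b = v b) :
    MemW1pC p a c (fun t => if t ≤ b then u t else v t)
      (fun t => if t ≤ b then u' t else v' t) := by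
  obtain ⟨h1, h2⟩ := hu.1.ite hab hbc hv.1
  refine ⟨h1.trans h2, fun t ht => ?_, ?_⟩
  · simp only [hab, if_true]
    split_ifs with h
    · rw [hu.2.1 t ⟨ht.1, h⟩]
      congr 1
      refine intervalIntegral.integral_congr_ae (ae_of_all _ fun s hs => ?_)
      rw [uIoc_of_le ht.1] at hs
      simp [hs.2.trans h]
    · have hbt : b ≤ t := (not_le.1 h).le
      rw [intervalIntegral_ite hab hbt hu.1
        (hv.1.mono_Icc (left_mem_Icc.2 hbc) ⟨hbt, ht.2⟩), hv.2.1 t ⟨hbt, ht.2⟩, ← hb,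
        hu.2.1 b (right_mem_Icc.2 hab)]
      ring
  · rw [← intervalIntegrable_iff_integrableOn_Ioo_of_le (hab.trans hbc)]
    obtain ⟨h1, h2⟩ := (hu.intervalIntegrable_rpow hab).ite hab hbc (hv.intervalIntegrable_rpow hbc)
    refine (h1.trans h2).congr fun t _ => ?_
    simp only
    split_ifs <;> rfl

lemma MemW1pC.ae_eq {p α β : ℝ} {u u' v v' : ℝ → ℝ} (hu : MemW1pC p α β u u')
    (hv : MemW1pC p α β v v') (h : ∀ t ∈ Ioo α β, u t = v t) :
    ∀ᵐ x ∂(volume.restrict (Ioo α β)), u' x = v' x := by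
  rw [ae_restrict_iff' measurableSet_Ioo]
  filter_upwards [hu.ae_hasDerivAt, hv.ae_hasDerivAt] with x h1 h2 hx
  refine (h1 hx).unique ((h2 hx).congr_of_eventuallyEq ?_)
  filter_upwards [Ioo_mem_nhds hx.1 hx.2] with t ht using h t ht

lemma intervalIntegral_fold {f : ℝ → ℝ} {T : ℝ} (hT : 0 < T)
    (hf : IntervalIntegrable f volume (-T) T) :
    ∫ t in (-T)..T, (if t ≤ 0 then f (2 * t + T) else f (-2 * t + T)) = ∫ t in (-T)..T, f t := by
  have e1 : (2 : ℝ) * -T + T = -T := by ring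
  have e2 : (2 : ℝ) * 0 + T = T := by ring
  have e3 : (-2 : ℝ) * 0 + T = T := by ring
  have e4 : (-2 : ℝ) * T + T = -T := by ring
  rw [intervalIntegral_ite (by linarith) hT.le
    (IntervalIntegrable.comp_affine two_ne_zero (by rwa [e1, e2]))
    (IntervalIntegrable.comp_affine (by norm_num) (by rw [e3, e4]; exact hf.symm)),
    intervalIntegral.integral_comp_mul_add f two_ne_zero,
    intervalIntegral.integral_comp_mul_add f (by norm_num), e1, e2, e3, e4,
    intervalIntegral.integral_symm (-T) T, smul_eq_mul, smul_eq_mul]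
  ring

/-- Even reflection turns a function on `(-T, T)` vanishing at the left endpoint into a function
vanishing at both endpoints. -/
lemma MemW1pC.fold {p T : ℝ} {G g : ℝ → ℝ} (hp : 1 < p) (hT : 0 < T)
    (hG : MemW1pC p (-T) T G g) (hG0 : G (-T) = 0) :
    MemW1p0 p (-T) T (fun t => if t ≤ 0 then G (2 * t + T) else G (-2 * t + T))
      (fun t => if t ≤ 0 then 2 * g (2 * t + T) else -2 * g (-2 * t + T)) ∧
    (∫ t in Ioo (-T) T, |if t ≤ 0 then G (2 * t + T) else G (-2 * t + T)| ^ p) =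
      ∫ t in Ioo (-T) T, |G t| ^ p ∧
    (∫ t in Ioo (-T) T, |if t ≤ 0 then 2 * g (2 * t + T) else -2 * g (-2 * t + T)| ^ p) =
      2 ^ p * ∫ t in Ioo (-T) T, |g t| ^ p := by
  have hTT : -T ≤ T := by linarith
  refine ⟨⟨?_, ?_, ?_⟩, ?_, ?_⟩
  · refine MemW1pC.glue (by linarith) hT.le
      (hG.comp_affine two_ne_zero (by linarith) ?_ ?_)
      (hG.comp_affine (by norm_num) hT.le ?_ ?_) (by simp)
    all_goals constructor <;> linarith
  · have : -(2 * T) + T = -T := by ring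
    simp [hT.le, this, hG0]
  · have : -(2 * T) + T = -T := by ring
    simp [hT, this, hG0]
  · simp_rw [setIntegral_Ioo_eq_intervalIntegral hTT]
    rw [← intervalIntegral_fold hT ((intervalIntegrable_iff_integrableOn_Ioo_of_le hTT).2
      (hG.integrableOn_abs_rpow hp hTT))]
    refine intervalIntegral.integral_congr fun t _ => ?_
    split_ifs <;> rfl
  · simp_rw [setIntegral_Ioo_eq_intervalIntegral hTT]
    rw [← intervalIntegral_fold hT (hG.intervalIntegrable_rpow hTT),
      ← intervalIntegral.integral_const_mul]
    refine intervalIntegral.integral_congr fun t _ => ?_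
    split_ifs <;> simp [abs_mul, Real.mul_rpow]

lemma lam1_mul_le_of_left_eq_zero {p T : ℝ} {G g : ℝ → ℝ} (hp : 1 < p) (hT : 0 < T)
    (hG : MemW1pC p (-T) T G g) (hG0 : G (-T) = 0) :
    lam1 p (-T) T * ∫ t in Ioo (-T) T, |G t| ^ p ≤ 2 ^ p * ∫ t in Ioo (-T) T, |g t| ^ p := by
  obtain ⟨h1, h2, h3⟩ := hG.fold hp hT hG0
  rw [← h2, ← h3]
  exact lam1_mul_le hp h1

lemma IsPrincipalEigenfunction.eq_of_left_eq_zero {p T : ℝ} {φ φ' G g : ℝ → ℝ} (hp : 1 < p)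
    (hT : 0 < T) (hφ : IsPrincipalEigenfunction p T φ φ') (hG : MemW1pC p (-T) T G g)
    (hG0 : G (-T) = 0) (hnn : ∀ t ∈ Icc (-T) T, 0 ≤ G t)
    (hE : 2 ^ p * ∫ t in Ioo (-T) T, |g t| ^ p ≤ lam1 p (-T) T * ∫ t in Ioo (-T) T, |G t| ^ p) :
    ∃ c, 0 ≤ c ∧ ∀ t ∈ Icc (-T) T, G t = c * φ ((t - T) / 2) := by
  obtain ⟨h1, h2, h3⟩ := hG.fold hp hT hG0
  rw [← h2, ← h3] at hE
  obtain ⟨c, hc, h⟩ := hφ.eq_const_mul hp hT h1 (fun t ht => by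
    split_ifs with h0
    · exact hnn _ ⟨by linarith [ht.1], by linarith⟩
    · exact hnn _ ⟨by linarith [ht.2], by linarith⟩) hE
  refine ⟨c, hc, fun t ht => ?_⟩
  have ht0 : (t - T) / 2 ≤ 0 := by linarith [ht.2]
  have := h ((t - T) / 2) ⟨by linarith [ht.1], by linarith⟩
  simp only [ht0, if_true] at this
  rwa [show 2 * ((t - T) / 2) + T = t by ring] at this

lemma IsPrincipalEigenfunction.even {p T : ℝ} {φ φ' : ℝ → ℝ} (hp : 1 < p)
    (hT : 0 < T) (hφ : IsPrincipalEigenfunction p T φ φ') {t : ℝ} (ht : t ∈ Icc (-T) T) :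
    φ (-t) = φ t := by
  have hTT : -T ≤ T := by linarith
  have hfold : ∀ f : ℝ → ℝ, ∫ t in Ioo (-T) T, f (-1 * t + 0) = ∫ t in Ioo (-T) T, f t := by
    intro f
    rw [setIntegral_Ioo_eq_intervalIntegral hTT, setIntegral_Ioo_eq_intervalIntegral hTT]
    simp
  have hmem : MemW1p0 p (-T) T (fun t => φ (-1 * t + 0)) (fun t => -1 * φ' (-1 * t + 0)) := by
    refine ⟨hφ.1.1.comp_affine (by norm_num) hTT ⟨by linarith, by linarith⟩
      ⟨by linarith, by linarith⟩, ?_, ?_⟩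
    · simp [hφ.1.2.2]
    · simp [hφ.1.2.1]
  obtain ⟨c, -, h⟩ := hφ.eq_const_mul hp hT hmem (fun t ht => by
    rcases ht.1.eq_or_lt with h | h
    · simp [← h, hφ.1.2.2]
    rcases ht.2.eq_or_lt with h' | h'
    · simp [h', hφ.1.2.1]
    · exact (hφ.2.1 _ ⟨by linarith, by linarith⟩).le) (by
    rw [hfold (fun t => |φ t| ^ p), hφ.2.2.1, mul_one, ← hφ.2.2.2, ← hfold (fun t => |φ' t| ^ p)]
    simp)
  have h0 : (0 : ℝ) ∈ Ioo (-T) T := ⟨by linarith, hT⟩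
  have hc := h 0 (Ioo_subset_Icc_self h0)
  have hφ0 := hφ.2.1 0 h0
  simp only [mul_zero, add_zero] at hc
  have : c = 1 := by
    have : (c - 1) * φ 0 = 0 := by linarith
    rcases mul_eq_zero.1 this with h | h <;> linarith
  have := h t ht
  simp only [‹c = 1›, one_mul] at this
  simpa using this

/-- The half-profile `t ↦ φ ((t - T) / 2)` of the principal eigenfunction. -/
lemma IsPrincipalEigenfunction.half {p T : ℝ} {φ φ' : ℝ → ℝ} (hp : 1 < p)
    (hT : 0 < T) (hφ : IsPrincipalEigenfunction p T φ φ') :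
    MemW1pC p (-T) T (fun t => φ ((t - T) / 2)) (fun t => φ' ((t - T) / 2) / 2) ∧
    (∫ t in Ioo (-T) T, |φ ((t - T) / 2)| ^ p) = 1 ∧
    2 ^ p * (∫ t in Ioo (-T) T, |φ' ((t - T) / 2) / 2| ^ p) = lam1 p (-T) T := by
  have hTT : -T ≤ T := by linarith
  have hmem : MemW1pC p (-T) T (fun t => φ ((t - T) / 2)) (fun t => φ' ((t - T) / 2) / 2) := by
    have := hφ.1.1.comp_affine (c := 1 / 2) (d := -(T / 2)) (by norm_num) hTT
      ⟨by linarith, by linarith⟩ ⟨by linarith, by linarith⟩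
    have e : ∀ t : ℝ, 1 / 2 * t + -(T / 2) = (t - T) / 2 := fun t => by ring
    simp only [e] at this
    simpa only [one_div, inv_mul_eq_div] using this
  have h0 : φ ((-T - T) / 2) = 0 := by
    rw [show (-T - T) / 2 = -T by ring, hφ.1.2.1]
  obtain ⟨h1, h2, h3⟩ := hmem.fold hp hT h0
  have heq : ∀ t ∈ Ioo (-T) T, (if t ≤ 0 then φ ((2 * t + T - T) / 2)
      else φ ((-2 * t + T - T) / 2)) = φ t := by
    intro t ht
    rw [show (2 * t + T - T) / 2 = t by ring, show (-2 * t + T - T) / 2 = -t by ring,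
      hφ.even hp hT (Ioo_subset_Icc_self ht), ite_self]
  refine ⟨hmem, ?_, ?_⟩
  · rw [← h2, ← hφ.2.2.1]
    exact setIntegral_congr_fun measurableSet_Ioo fun t ht => by simp only [heq t ht]
  · rw [← h3, ← hφ.2.2.2]
    refine integral_congr_ae ?_
    filter_upwards [h1.1.ae_eq hφ.1.1 heq] with x hx
    rw [hx]

lemma lamPlus_nonneg (p T : ℝ) : 0 ≤ lamPlus p T := by
  refine Real.sInf_nonneg ?_
  rintro E ⟨w, w', -, -, rfl⟩
  exact integral_nonneg fun t => Real.rpow_nonneg (ppart_nonneg _) _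

lemma lamPlus_mul_le_of_left_eq_zero {p T : ℝ} {ψ ψ' : ℝ → ℝ} (hp : 1 < p) (hT : 0 < T)
    (hψ : MemW1pC p (-T) T ψ ψ') (hψ0 : ψ (-T) = 0) (hnn : ∀ t ∈ Icc (-T) T, 0 ≤ ψ t) :
    lamPlus p T * ∫ t in Ioo (-T) T, |ψ t| ^ p ≤ ∫ t in Ioo (-T) T, |ψ' t| ^ p := by
  have hTT : -T ≤ T := by linarith
  have hp0 : 0 < p := by linarith
  have hcut : ∀ b ∈ Ioo (-T) T,
      lamPlus p T * ∫ t in (-T)..b, |ψ t| ^ p ≤ ∫ t in Ioo (-T) T, |ψ' t| ^ p := by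
    intro b hb
    have hbT : 0 < T - b := by linarith [hb.2]
    have hψb := hnn b (Ioo_subset_Icc_self hb)
    have hleft : MemW1pC p (-T) b ψ ψ' := by
      have := hψ.comp_affine (a := -T) (b := b) (c := 1) (d := 0) one_ne_zero hb.1.le
        ⟨by linarith, by linarith⟩ ⟨by linarith [hb.1], by linarith⟩
      simpa using this
    have hright : MemW1pC p b T (fun t => ψ b / (T - b) * (T - t)) (fun _ => -(ψ b / (T - b))) := by
      refine ⟨intervalIntegrable_const, fun t _ => ?_, integrableOn_const (by simp)⟩
      rw [intervalIntegral.integral_const, smul_eq_mul]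
      ring
    have hmem := hleft.glue hb.1.le hb.2.le hright (by field_simp)
    have h0 : MemW1p0 p (-T) T _ _ := ⟨hmem, by simp [hb.1.le, hψ0], by simp [hb.2]⟩
    refine le_trans ?_ ((lamPlus_mul_le hp h0).trans ?_)
    · refine mul_le_mul_of_nonneg_left ?_ (lamPlus_nonneg p T)
      rw [← setIntegral_Ioo_eq_intervalIntegral hb.1.le]
      refine le_trans (le_of_eq ?_) (setIntegral_mono_set (hmem.integrableOn_abs_rpow hp hTT)
        (ae_of_all _ fun t => Real.rpow_nonneg (abs_nonneg _) _)
        (Ioo_subset_Ioo_right hb.2.le).eventuallyLE)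
      exact setIntegral_congr_fun measurableSet_Ioo fun t ht => by simp [ht.2.le]
    · refine integral_mono_of_nonneg
        (ae_of_all _ fun t => Real.rpow_nonneg (ppart_nonneg _) _) hψ.2.2 (ae_of_all _ fun t => ?_)
      simp only
      split_ifs
      · exact Real.rpow_le_rpow (ppart_nonneg _) (ppart_le_abs _) hp0.le
      · have : ppart (-(ψ b / (T - b))) = 0 :=
          max_eq_right (neg_nonpos.2 (div_nonneg hψb hbT.le))
        rw [this, Real.zero_rpow hp0.ne']
        exact Real.rpow_nonneg (abs_nonneg _) _
  have hint : IntervalIntegrable (fun t => |ψ t| ^ p) volume (-T) T :=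
    (intervalIntegrable_iff_integrableOn_Ioo_of_le hTT).2 (hψ.integrableOn_abs_rpow hp hTT)
  have hcont : ContinuousOn (fun b => ∫ t in (-T)..b, |ψ t| ^ p) (Icc (-T) T) := by
    have := hint.absolutelyContinuousOnInterval_intervalIntegral (c := -T) left_mem_uIcc
    simpa [uIcc_of_le hTT] using this.continuousOn
  have htend : Tendsto (fun b => lamPlus p T * ∫ t in (-T)..b, |ψ t| ^ p) (𝓝[Ioo (-T) T] T)
      (𝓝 (lamPlus p T * ∫ t in (-T)..T, |ψ t| ^ p)) :=
    ((hcont T (right_mem_Icc.2 hTT)).mono_left (nhdsWithin_mono _ Ioo_subset_Icc_self)).const_mul _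
  rw [setIntegral_Ioo_eq_intervalIntegral hTT (fun t => |ψ t| ^ p)]
  have : (𝓝[Ioo (-T) T] T).NeBot := by
    rw [← mem_closure_iff_nhdsWithin_neBot, closure_Ioo (by linarith)]
    exact right_mem_Icc.2 hTT
  exact le_of_tendsto htend (eventually_nhdsWithin_of_forall hcut)

lemma MemW1pI.exists_memW1pC {p α β : ℝ} {u u' : ℝ → ℝ} (hαβ : α < β)
    (h : MemW1pI p α β u u') :
    ∃ v, MemW1pC p α β v u' ∧ ∀ t ∈ Ioo α β, u t = v t := by
  obtain ⟨h1, h2, h3⟩ := h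
  obtain ⟨s, hs⟩ := nonempty_Ioo.2 hαβ
  have hs' := Ioo_subset_Icc_self hs
  have hα := left_mem_Icc.2 hαβ.le
  refine ⟨fun t => u s + ∫ r in s..t, u' r, ⟨h1, fun t ht => ?_, h3⟩, fun t ht => h2 s hs t ht⟩
  simp only
  rw [add_assoc, intervalIntegral.integral_add_adjacent_intervals (h1.mono_Icc hs' hα)
    (h1.mono_Icc hα ht)]

lemma MemW1pI.continuousOn {p α β : ℝ} {u u' : ℝ → ℝ} (hαβ : α < β) (h : MemW1pI p α β u u') :
    ContinuousOn u (Ioo α β) := by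
  obtain ⟨v, hv, huv⟩ := h.exists_memW1pC hαβ
  exact ((hv.continuousOn hαβ.le).mono Ioo_subset_Icc_self).congr huv

lemma MemW1pI.intervalIntegrable {p α β : ℝ} {u u' : ℝ → ℝ} (hαβ : α < β)
    (h : MemW1pI p α β u u') : IntervalIntegrable u volume α β := by
  obtain ⟨v, hv, huv⟩ := h.exists_memW1pC hαβ
  rw [intervalIntegrable_iff_integrableOn_Ioo_of_le hαβ.le]
  exact ((hv.continuousOn hαβ.le).integrableOn_compact isCompact_Icc).mono_set
    Ioo_subset_Icc_self |>.congr_fun (fun t ht => (huv t ht).symm) measurableSet_Ioo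

/-- The positive part of `u'` on the set where `u` is positive. -/
def posSlope (u u' : ℝ → ℝ) (t : ℝ) : ℝ := if 0 < u t then ppart (u' t) else 0

lemma posSlope_nonneg (u u' : ℝ → ℝ) (t : ℝ) : 0 ≤ posSlope u u' t := by
  unfold posSlope
  split_ifs
  exacts [ppart_nonneg _, le_rfl]

lemma posSlope_le_abs (u u' : ℝ → ℝ) (t : ℝ) : posSlope u u' t ≤ |u' t| := by
  unfold posSlope
  split_ifs
  exacts [ppart_le_abs _, abs_nonneg _]

lemma MemW1pI.ppart_le {p α β s t : ℝ} {u u' : ℝ → ℝ} (h : MemW1pI p α β u u')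
    (hg : IntervalIntegrable (posSlope u u') volume α β) (hs : s ∈ Ioo α β) (ht : t ∈ Ioo α β)
    (hst : s ≤ t) : ppart (u t) ≤ ppart (u s) + ∫ r in s..t, posSlope u u' r := by
  have hαβ : α < β := hs.1.trans hs.2
  have hI : Ioo α β ⊆ Icc α β := Ioo_subset_Icc_self
  have hsub : Icc s t ⊆ Ioo α β := fun r hr => ⟨hs.1.trans_le hr.1, hr.2.trans_lt ht.2⟩
  have hint : ∀ z ∈ Icc s t, IntervalIntegrable (posSlope u u') volume z t := fun z hz =>
    hg.mono_Icc (hI (hsub hz)) (hI ht)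
  have hpos : ∀ a b, a ≤ b → 0 ≤ ∫ r in a..b, posSlope u u' r := fun a b hab =>
    intervalIntegral.integral_nonneg hab fun r _ => posSlope_nonneg u u' r
  by_cases hut : u t ≤ 0
  · rw [ppart, max_eq_right hut]
    exact add_nonneg (ppart_nonneg _) (hpos _ _ hst)
  push Not at hut
  obtain ⟨z, hz, hzs, hzt⟩ : ∃ z ∈ Icc s t, u z ≤ ppart (u s) ∧ ∀ r ∈ Ioc z t, 0 < u r := by
    by_cases hZ : (Icc s t ∩ u ⁻¹' Iic 0).Nonempty
    · have hcomp : IsCompact (Icc s t ∩ u ⁻¹' Iic 0) :=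
        isCompact_Icc.of_isClosed_subset (((h.continuousOn hαβ).mono
          hsub).preimage_isClosed_of_isClosed isClosed_Icc isClosed_Iic) inter_subset_left
      obtain ⟨z, hz, hzmax⟩ := hcomp.exists_isGreatest hZ
      refine ⟨z, hz.1, le_trans hz.2 (ppart_nonneg _), fun r hr => ?_⟩
      by_contra hneg
      exact absurd (hzmax ⟨⟨hz.1.1.trans hr.1.le, hr.2⟩, not_lt.1 hneg⟩) (not_le.2 hr.1)
    · refine ⟨s, left_mem_Icc.2 hst, le_ppart _, fun r hr => ?_⟩
      by_contra hneg
      exact hZ ⟨r, ⟨hr.1.le, hr.2⟩, not_lt.1 hneg⟩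
  have h1 : u t = u z + ∫ r in z..t, u' r := h.2.1 z (hsub hz) t ht
  have h2 : ∫ r in z..t, u' r ≤ ∫ r in z..t, posSlope u u' r := by
    rw [intervalIntegral.integral_of_le hz.2, intervalIntegral.integral_of_le hz.2]
    refine setIntegral_mono_on ((h.1.mono_Icc (hI (hsub hz)) (hI ht)).1) (hint z hz).1
      measurableSet_Ioc fun r hr => ?_
    rw [posSlope, if_pos (hzt r hr)]
    exact le_ppart _
  have h3 : ∫ r in z..t, posSlope u u' r ≤ ∫ r in s..t, posSlope u u' r := by
    rw [← intervalIntegral.integral_add_adjacent_intervals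
      (hg.mono_Icc (hI hs) (hI (hsub hz))) (hint z hz)]
    linarith [hpos s z hz.1]
  rw [show ppart (u t) = u t from max_eq_left hut.le, h1]
  linarith

/-- A partition of `(-T, T)` adapted to a function of the class `W_pw^{1,p,+}(-T,T)`. -/
structure IsAdapted (p T : ℝ) (u u' : ℝ → ℝ) (m : ℕ) (P : ℕ → ℝ) : Prop where
  pos : 0 < m
  left : P 0 = -T
  right : P m = T
  lt_succ : ∀ i < m, P i < P (i + 1)
  mem : ∀ i < m, MemW1pI p (P i) (P (i + 1)) u u'
  left_lim : ∃ l₀, Tendsto u (𝓝[>] (-T)) (𝓝 l₀) ∧ l₀ ≤ 0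
  right_lim : ∃ l₁, Tendsto u (𝓝[<] T) (𝓝 l₁) ∧ 0 ≤ l₁
  jump : ∀ i, 0 < i → i < m → ∃ lm lp, Tendsto u (𝓝[<] (P i)) (𝓝 lm) ∧
    Tendsto u (𝓝[>] (P i)) (𝓝 lp) ∧ lp < lm

lemma MemWpw.exists_isAdapted {p T : ℝ} {u u' : ℝ → ℝ} (h : MemWpw p T u u') :
    ∃ m P, IsAdapted p T u u' m P := by
  obtain ⟨m, P, h1, h2, h3, h4, h5, h6, h7, h8⟩ := h
  exact ⟨m, P, h1, h2, h3, h4, h5, h6, h7, h8⟩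

namespace IsAdapted

variable {p T : ℝ} {u u' : ℝ → ℝ} {m : ℕ} {P : ℕ → ℝ}

lemma monotone (h : IsAdapted p T u u' m P) {i j : ℕ} (hij : i ≤ j) (hj : j ≤ m) : P i ≤ P j := by
  induction j, hij using Nat.le_induction with
  | base => exact le_rfl
  | succ j _ ih => exact (ih (by omega)).trans (h.lt_succ j (by omega)).le

lemma mem_Icc (h : IsAdapted p T u u' m P) {i : ℕ} (hi : i ≤ m) : P i ∈ Icc (-T) T :=
  ⟨h.left ▸ h.monotone (Nat.zero_le i) hi, h.right ▸ h.monotone hi le_rfl⟩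

lemma neg_lt (h : IsAdapted p T u u' m P) : -T < T := by
  rw [← h.left]
  exact (h.lt_succ 0 h.pos).trans_le (h.mem_Icc h.pos).2

lemma exists_mem_Ioo (h : IsAdapted p T u u' m P) {t : ℝ} (ht : t ∈ Ioo (-T) T)
    (hP : t ∉ range P) : ∃ i < m, t ∈ Ioo (P i) (P (i + 1)) := by
  by_contra hcon
  push Not at hcon
  have key : ∀ i ≤ m, P i < t := by
    intro i
    induction i with
    | zero => intro _; rw [h.left]; exact ht.1
    | succ i ih =>
      intro hi
      have h1 := ih (by omega)
      by_contra hle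
      rcases (not_lt.1 hle).eq_or_lt with h2 | h2
      · exact hP ⟨_, h2.symm⟩
      · exact hcon i (by omega) ⟨h1, h2⟩
  have := key m le_rfl
  rw [h.right] at this
  exact absurd ht.2 (not_lt.2 this.le)

lemma ae_of_forall_piece (h : IsAdapted p T u u' m P) {q : ℝ → Prop}
    (hq : ∀ i < m, ∀ t ∈ Ioo (P i) (P (i + 1)), q t) :
    ∀ᵐ t ∂(volume.restrict (Ioo (-T) T)), q t := by
  rw [ae_restrict_iff' measurableSet_Ioo]
  filter_upwards [(countable_range P).ae_notMem volume] with t ht htT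
  obtain ⟨i, hi, hti⟩ := h.exists_mem_Ioo htT ht
  exact hq i hi t hti

lemma intervalIntegrable_of_forall_piece (h : IsAdapted p T u u' m P) {f : ℝ → ℝ}
    (hf : ∀ i < m, IntervalIntegrable f volume (P i) (P (i + 1))) :
    IntervalIntegrable f volume (-T) T := by
  have := IntervalIntegrable.trans_iterate hf
  rwa [h.left, h.right] at this

lemma intervalIntegrable (h : IsAdapted p T u u' m P) : IntervalIntegrable u volume (-T) T :=
  h.intervalIntegrable_of_forall_piece fun i hi => (h.mem i hi).intervalIntegrable (h.lt_succ i hi)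

lemma intervalIntegrable_deriv (h : IsAdapted p T u u' m P) :
    IntervalIntegrable u' volume (-T) T :=
  h.intervalIntegrable_of_forall_piece fun i hi => (h.mem i hi).1

lemma integrableOn_rpow (h : IsAdapted p T u u' m P) :
    IntegrableOn (fun t => |u' t| ^ p) (Ioo (-T) T) := by
  rw [← intervalIntegrable_iff_integrableOn_Ioo_of_le h.neg_lt.le]
  exact h.intervalIntegrable_of_forall_piece fun i hi =>
    (intervalIntegrable_iff_integrableOn_Ioo_of_le (h.lt_succ i hi).le).2 (h.mem i hi).2.2

lemma aestronglyMeasurable (h : IsAdapted p T u u' m P) :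
    AEStronglyMeasurable u (volume.restrict (Ioo (-T) T)) :=
  ((intervalIntegrable_iff_integrableOn_Ioo_of_le h.neg_lt.le).1
    h.intervalIntegrable).aestronglyMeasurable

lemma aestronglyMeasurable_deriv (h : IsAdapted p T u u' m P) :
    AEStronglyMeasurable u' (volume.restrict (Ioo (-T) T)) :=
  ((intervalIntegrable_iff_integrableOn_Ioo_of_le h.neg_lt.le).1
    h.intervalIntegrable_deriv).aestronglyMeasurable

lemma aestronglyMeasurable_posSlope (h : IsAdapted p T u u' m P) :
    AEStronglyMeasurable (posSlope u u') (volume.restrict (Ioo (-T) T)) := by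
  have h1 : AEStronglyMeasurable (fun t => ppart (u' t)) (volume.restrict (Ioo (-T) T)) :=
    (measurable_ppart.comp_aemeasurable
      h.aestronglyMeasurable_deriv.aemeasurable).aestronglyMeasurable
  have h2 : NullMeasurableSet {t | 0 < u t} (volume.restrict (Ioo (-T) T)) :=
    nullMeasurableSet_lt aemeasurable_const h.aestronglyMeasurable.aemeasurable
  have := h1.indicator₀ h2
  refine this.congr (ae_of_all _ fun t => ?_)
  simp [posSlope, indicator_apply]

lemma memW1pC_posSlope (h : IsAdapted p T u u' m P) (hp : 1 < p) :
    MemW1pC p (-T) T (fun t => ∫ r in (-T)..t, posSlope u u' r) (posSlope u u') := by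
  have hTT := h.neg_lt.le
  refine ⟨?_, fun t _ => by simp, ?_⟩
  · rw [intervalIntegrable_iff_integrableOn_Ioo_of_le hTT]
    refine ((intervalIntegrable_iff_integrableOn_Ioo_of_le hTT).1
      h.intervalIntegrable_deriv).abs.mono' h.aestronglyMeasurable_posSlope
      (ae_of_all _ fun t => ?_)
    rw [Real.norm_of_nonneg (posSlope_nonneg _ _ _)]
    exact posSlope_le_abs _ _ _
  · refine h.integrableOn_rpow.mono'
      (h.aestronglyMeasurable_posSlope.aemeasurable.abs.pow_const p).aestronglyMeasurable
      (ae_of_all _ fun t => ?_)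
    rw [Real.norm_of_nonneg (Real.rpow_nonneg (abs_nonneg _) _),
      abs_of_nonneg (posSlope_nonneg _ _ _)]
    exact Real.rpow_le_rpow (posSlope_nonneg _ _ _) (posSlope_le_abs _ _ _) (by linarith)

lemma ppart_le_of_limit (h : IsAdapted p T u u' m P) (hp : 1 < p) {i : ℕ} (hi : i < m) {l : ℝ}
    (hl : Tendsto u (𝓝[>] (P i)) (𝓝 l)) (hle : ppart l ≤ ∫ r in (-T)..(P i), posSlope u u' r)
    {t : ℝ} (ht : t ∈ Ioo (P i) (P (i + 1))) :
    ppart (u t) ≤ ∫ r in (-T)..t, posSlope u u' r := by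
  have hg := (h.memW1pC_posSlope hp).1
  have hPi := h.mem_Icc hi.le
  have hPi' := h.mem_Icc (Nat.succ_le_of_lt hi)
  have htT : t ∈ Icc (-T) T := ⟨hPi.1.trans ht.1.le, ht.2.le.trans hPi'.2⟩
  have hT : -T ∈ Icc (-T) T := left_mem_Icc.2 h.neg_lt.le
  rw [← intervalIntegral.integral_add_adjacent_intervals (hg.mono_Icc hT hPi)
    (hg.mono_Icc hPi htT)]
  have hcont : Continuous ppart := continuous_id.max continuous_const
  have htend : Tendsto (fun s => ppart (u s) + ∫ r in (P i)..t, posSlope u u' r) (𝓝[>] (P i))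
      (𝓝 (ppart l + ∫ r in (P i)..t, posSlope u u' r)) :=
    ((hcont.tendsto l).comp hl).add_const _
  refine le_trans (ge_of_tendsto htend ?_) (add_le_add_left hle _)
  filter_upwards [Ioo_mem_nhdsGT ht.1] with s hs
  have hs' : s ∈ Ioo (P i) (P (i + 1)) := ⟨hs.1, hs.2.trans ht.2⟩
  have hsT : s ∈ Icc (-T) T := ⟨hPi.1.trans hs.1.le, hs.2.le.trans htT.2⟩
  refine ((h.mem i hi).ppart_le (hg.mono_Icc hPi hPi') hs' ht hs.2.le).trans ?_
  rw [← intervalIntegral.integral_add_adjacent_intervals (hg.mono_Icc hPi hsT)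
    (hg.mono_Icc hsT htT)]
  have := intervalIntegral.integral_nonneg (μ := volume) hs.1.le
    fun r _ => posSlope_nonneg u u' r
  linarith

lemma exists_limit_ppart_le (h : IsAdapted p T u u' m P) (hp : 1 < p) {i : ℕ} (hi : i < m) :
    ∃ l, Tendsto u (𝓝[>] (P i)) (𝓝 l) ∧ ppart l ≤ ∫ r in (-T)..(P i), posSlope u u' r := by
  induction i with
  | zero =>
    obtain ⟨l, hl, hl0⟩ := h.left_lim
    refine ⟨l, by rwa [h.left], ?_⟩
    rw [h.left, intervalIntegral.integral_same, ppart, max_eq_right hl0]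
  | succ i ih =>
    have hi' : i < m := by omega
    obtain ⟨l, hl, hle⟩ := ih hi'
    obtain ⟨lm, lp, hlm, hlp, hlt⟩ := h.jump (i + 1) (Nat.succ_pos i) hi
    refine ⟨lp, hlp, (max_le_max_right 0 hlt.le).trans ?_⟩
    have hg := (h.memW1pC_posSlope hp).1
    have hcont : Continuous ppart := continuous_id.max continuous_const
    have hT : -T ∈ Icc (-T) T := left_mem_Icc.2 h.neg_lt.le
    have hP := h.mem_Icc hi.le
    refine le_of_tendsto ((hcont.tendsto lm).comp hlm) ?_
    filter_upwards [Ioo_mem_nhdsLT (h.lt_succ i hi')] with t ht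
    have htT : t ∈ Icc (-T) T := ⟨(h.mem_Icc hi'.le).1.trans ht.1.le, ht.2.le.trans hP.2⟩
    refine (h.ppart_le_of_limit hp hi' hl hle ht).trans ?_
    rw [← intervalIntegral.integral_add_adjacent_intervals (hg.mono_Icc hT htT)
      (hg.mono_Icc htT hP)]
    have := intervalIntegral.integral_nonneg (μ := volume) ht.2.le
      fun r _ => posSlope_nonneg u u' r
    linarith

lemma ae_ppart_le (h : IsAdapted p T u u' m P) (hp : 1 < p) :
    ∀ᵐ t ∂(volume.restrict (Ioo (-T) T)), ppart (u t) ≤ ∫ r in (-T)..t, posSlope u u' r :=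
  h.ae_of_forall_piece fun _ hi _ ht =>
    let ⟨_, hl, hle⟩ := h.exists_limit_ppart_le hp hi
    h.ppart_le_of_limit hp hi hl hle ht

/-- A member of the class that agrees a.e. with a continuous function has no jumps. -/
lemma eq_of_ae_eq (h : IsAdapted p T u u' m P) {f : ℝ → ℝ} (hf : ContinuousOn f (Ioo (-T) T))
    (hae : ∀ᵐ t ∂(volume.restrict (Ioo (-T) T)), u t = f t) :
    MemW1pI p (-T) T u u' ∧ ∀ t ∈ Ioo (-T) T, u t = f t := by
  have hpiece : ∀ i < m, ∀ t ∈ Ioo (P i) (P (i + 1)), u t = f t := by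
    intro i hi
    have hsub : Ioo (P i) (P (i + 1)) ⊆ Ioo (-T) T :=
      Ioo_subset_Ioo (h.mem_Icc hi.le).1 (h.mem_Icc (Nat.succ_le_of_lt hi)).2
    exact Measure.eqOn_open_of_ae_eq (ae_restrict_of_ae_restrict_of_subset hsub hae) isOpen_Ioo
      ((h.mem i hi).continuousOn (h.lt_succ i hi)) (hf.mono hsub)
  have hm : m = 1 := by
    by_contra hm
    have h1 : 1 < m := by have := h.pos; omega
    obtain ⟨lm, lp, hlm, hlp, hlt⟩ := h.jump 1 one_pos h1
    have h01 := h.lt_succ 0 h.pos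
    have h12 := h.lt_succ 1 h1
    rw [zero_add] at h01
    have hmem : P 1 ∈ Ioo (-T) T :=
      ⟨h.left ▸ h01, h12.trans_le (h.mem_Icc (Nat.succ_le_of_lt h1)).2⟩
    have hc := (hf.continuousAt (Ioo_mem_nhds hmem.1 hmem.2)).tendsto
    have e1 : lm = f (P 1) := by
      refine tendsto_nhds_unique hlm ((hc.mono_left nhdsWithin_le_nhds).congr' ?_)
      filter_upwards [Ioo_mem_nhdsLT h01] with t ht
      exact (hpiece 0 h.pos t ht).symm
    have e2 : lp = f (P 1) := by
      refine tendsto_nhds_unique hlp ((hc.mono_left nhdsWithin_le_nhds).congr' ?_)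
      filter_upwards [Ioo_mem_nhdsGT h12] with t ht
      exact (hpiece 1 h1 t ht).symm
    rw [e1, e2] at hlt
    exact lt_irrefl _ hlt
  subst hm
  have h0 := h.mem 0 one_pos
  have h0' := hpiece 0 one_pos
  rw [zero_add, h.left, h.right] at h0 h0'
  exact ⟨h0, h0'⟩

end IsAdapted

lemma setIntegral_Ioo_comp_neg {T : ℝ} (hT : 0 < T) (f : ℝ → ℝ) :
    ∫ t in Ioo (-T) T, f (-t) = ∫ t in Ioo (-T) T, f t := by
  rw [setIntegral_Ioo_eq_intervalIntegral (by linarith),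
    setIntegral_Ioo_eq_intervalIntegral (by linarith), intervalIntegral.integral_comp_neg, neg_neg]

lemma MemW1pI.reflect {p α β : ℝ} {u u' : ℝ → ℝ} (hαβ : α ≤ β) (h : MemW1pI p α β u u') :
    MemW1pI p (-β) (-α) (fun t => -u (-t)) (fun t => u' (-t)) := by
  obtain ⟨h1, h2, h3⟩ := h
  refine ⟨?_, fun s hs t ht => ?_, ?_⟩
  · exact ((IntervalIntegrable.iff_comp_neg (by simp)).1 h1).symm
  · have := h2 (-t) ⟨by linarith [ht.2], by linarith [ht.1]⟩ (-s)
      ⟨by linarith [hs.2], by linarith [hs.1]⟩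
    rw [intervalIntegral.integral_comp_neg]
    linarith
  · rw [← intervalIntegrable_iff_integrableOn_Ioo_of_le hαβ] at h3
    rw [← intervalIntegrable_iff_integrableOn_Ioo_of_le (neg_le_neg hαβ)]
    exact ((IntervalIntegrable.iff_comp_neg (by simp)).1 h3).symm

lemma tendsto_endpoints_of_eqOn {a b : ℝ} {u f : ℝ → ℝ} (hab : a < b)
    (hf : ContinuousOn f (Icc a b)) (h : EqOn u f (Ioo a b)) :
    Tendsto u (𝓝[>] a) (𝓝 (f a)) ∧ Tendsto u (𝓝[<] b) (𝓝 (f b)) := by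
  rw [← nhdsWithin_Ioo_eq_nhdsGT hab, ← nhdsWithin_Ioo_eq_nhdsLT hab]
  exact ⟨((hf a (left_mem_Icc.2 hab.le)).mono_left (nhdsWithin_mono _ Ioo_subset_Icc_self)).congr'
      (eventually_nhdsWithin_of_forall fun t ht => (h ht).symm),
    ((hf b (right_mem_Icc.2 hab.le)).mono_left (nhdsWithin_mono _ Ioo_subset_Icc_self)).congr'
      (eventually_nhdsWithin_of_forall fun t ht => (h ht).symm)⟩

lemma MemW1p0.isAdapted {p T : ℝ} {u u' : ℝ → ℝ} (hT : 0 < T)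
    (h : MemW1p0 p (-T) T u u') : IsAdapted p T u u' 1 (fun i => if i = 0 then -T else T) := by
  obtain ⟨h, h0, h1⟩ := h
  have hlt : -T < T := by linarith
  have hc := h.continuousOn hlt.le
  refine ⟨one_pos, rfl, rfl, fun i hi => ?_, fun i hi => ?_, ⟨0, ?_, le_rfl⟩, ⟨0, ?_, le_rfl⟩,
    fun i h1 h2 => absurd h1 (by omega)⟩
  · obtain rfl : i = 0 := by omega
    simpa using hlt
  · obtain rfl : i = 0 := by omega
    simp only [zero_add, one_ne_zero, if_true, if_false]
    refine ⟨h.1, fun s hs t ht => ?_, h.2.2⟩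
    rw [← h.sub_eq (Ioo_subset_Icc_self hs) (Ioo_subset_Icc_self ht)]
    ring
  · exact h0 ▸ (tendsto_endpoints_of_eqOn hlt hc (eqOn_refl _ _)).1
  · exact h1 ▸ (tendsto_endpoints_of_eqOn hlt hc (eqOn_refl _ _)).2

lemma IsPrincipalEigenfunction.lam1_pos {p T : ℝ} {φ φ' : ℝ → ℝ} (hp : 1 < p) (hT : 0 < T)
    (hφ : IsPrincipalEigenfunction p T φ φ') : 0 < lam1 p (-T) T := by
  obtain ⟨⟨hm, h0, -⟩, hpos, -, hE⟩ := hφ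
  have hnn : 0 ≤ lam1 p (-T) T := by
    rw [← hE]
    exact integral_nonneg fun t => Real.rpow_nonneg (abs_nonneg _) _
  refine hnn.lt_of_ne' fun hz => ?_
  rw [hz, integral_eq_zero_iff_of_nonneg (fun t => Real.rpow_nonneg (abs_nonneg _) _) hm.2.2] at hE
  have hmem : (0 : ℝ) ∈ Ioo (-T) T := ⟨by linarith, hT⟩
  have := hm.2.1 0 (Ioo_subset_Icc_self hmem)
  rw [h0, intervalIntegral.integral_zero_ae, add_zero] at this
  · exact (hpos 0 hmem).ne' this
  · rw [EventuallyEq, ae_restrict_iff' measurableSet_Ioo] at hE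
    filter_upwards [hE] with t ht hts
    rw [uIoc_of_le (by linarith)] at hts
    have h2 := ht ⟨hts.1, by linarith [hts.2]⟩
    simpa [Real.rpow_eq_zero (abs_nonneg _) (by linarith : p ≠ 0)] using h2

lemma abs_rpow_eq_ppart_add {p : ℝ} (hp : p ≠ 0) (x : ℝ) :
    |x| ^ p = ppart x ^ p + ppart (-x) ^ p := by
  rcases le_total 0 x with h0 | h0
  · simp [ppart, h0, abs_of_nonneg, Real.zero_rpow hp]
  · simp [ppart, h0, abs_of_nonpos, Real.zero_rpow hp]

namespace IsAdapted

variable {p T : ℝ} {u u' : ℝ → ℝ} {m : ℕ} {P : ℕ → ℝ}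

lemma reflect (h : IsAdapted p T u u' m P) :
    IsAdapted p T (fun t => -u (-t)) (fun t => u' (-t)) m (fun i => -P (m - i)) := by
  have hGT : ∀ {a l : ℝ}, Tendsto u (𝓝[<] a) (𝓝 l) →
      Tendsto (fun t => -u (-t)) (𝓝[>] (-a)) (𝓝 (-l)) := fun {a l} hl => by
    have := tendsto_neg_nhdsGT (a := -a)
    rw [neg_neg] at this
    exact (hl.comp this).neg
  have hLT : ∀ {a l : ℝ}, Tendsto u (𝓝[>] a) (𝓝 l) →
      Tendsto (fun t => -u (-t)) (𝓝[<] (-a)) (𝓝 (-l)) := fun {a l} hl => by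
    have := tendsto_neg_nhdsLT (a := -a)
    rw [neg_neg] at this
    exact (hl.comp this).neg
  refine ⟨h.pos, ?_, ?_, fun i hi => ?_, fun i hi => ?_, ?_, ?_, fun i h1 h2 => ?_⟩
  · simp [h.right]
  · simp [h.left]
  · have := h.lt_succ (m - (i + 1)) (by omega)
    rw [show m - (i + 1) + 1 = m - i by omega] at this
    exact neg_lt_neg this
  · have hm := h.mem (m - (i + 1)) (by omega)
    have hl := h.lt_succ (m - (i + 1)) (by omega)
    rw [show m - (i + 1) + 1 = m - i by omega] at hm hl
    exact hm.reflect hl.le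
  · obtain ⟨l, hl, hl0⟩ := h.right_lim
    exact ⟨-l, hGT hl, by linarith⟩
  · obtain ⟨l, hl, hl0⟩ := h.left_lim
    have := hLT hl
    rw [neg_neg] at this
    exact ⟨-l, this, by linarith⟩
  · obtain ⟨lm, lp, hlm, hlp, hlt⟩ := h.jump (m - i) (by omega) (by omega)
    exact ⟨-lp, -lm, hLT hlp, hGT hlm, neg_lt_neg hlt⟩

lemma integral_posSlope_nonneg (t : ℝ) (ht : -T ≤ t) : 0 ≤ ∫ r in (-T)..t, posSlope u u' r :=
  intervalIntegral.integral_nonneg ht fun _ _ => posSlope_nonneg u u' _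

lemma ae_ppart_rpow_le (h : IsAdapted p T u u' m P) (hp : 1 < p) :
    ∀ᵐ t ∂(volume.restrict (Ioo (-T) T)),
      ppart (u t) ^ p ≤ |∫ r in (-T)..t, posSlope u u' r| ^ p := by
  filter_upwards [h.ae_ppart_le hp] with t ht
  exact Real.rpow_le_rpow (ppart_nonneg _) (ht.trans (le_abs_self _)) (by linarith)

lemma integrableOn_ppart_rpow (h : IsAdapted p T u u' m P) (hp : 1 < p) :
    IntegrableOn (fun t => ppart (u t) ^ p) (Ioo (-T) T) := by
  refine ((h.memW1pC_posSlope hp).integrableOn_abs_rpow hp h.neg_lt.le).mono'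
    ((measurable_ppart.comp_aemeasurable
      h.aestronglyMeasurable.aemeasurable).pow_const p).aestronglyMeasurable ?_
  filter_upwards [h.ae_ppart_rpow_le hp] with t ht
  rwa [Real.norm_of_nonneg (Real.rpow_nonneg (ppart_nonneg _) _)]

lemma integrableOn_ppart_deriv_rpow (h : IsAdapted p T u u' m P) (hp : 1 < p) :
    IntegrableOn (fun t => ppart (u' t) ^ p) (Ioo (-T) T) := by
  refine h.integrableOn_rpow.mono' ((measurable_ppart.comp_aemeasurable
      h.aestronglyMeasurable_deriv.aemeasurable).pow_const p).aestronglyMeasurable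
      (ae_of_all _ fun t => ?_)
  rw [Real.norm_of_nonneg (Real.rpow_nonneg (ppart_nonneg _) _)]
  exact Real.rpow_le_rpow (ppart_nonneg _) (ppart_le_abs _) (by linarith)

lemma integral_ppart_rpow_le (h : IsAdapted p T u u' m P) (hp : 1 < p) :
    ∫ t in Ioo (-T) T, ppart (u t) ^ p ≤
      ∫ t in Ioo (-T) T, |∫ r in (-T)..t, posSlope u u' r| ^ p :=
  integral_mono_ae (h.integrableOn_ppart_rpow hp)
    ((h.memW1pC_posSlope hp).integrableOn_abs_rpow hp h.neg_lt.le) (h.ae_ppart_rpow_le hp)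

lemma lam1_mul_le_posSlope (h : IsAdapted p T u u' m P) (hp : 1 < p) (hT : 0 < T)
    (hl : 0 ≤ lam1 p (-T) T) :
    lam1 p (-T) T * ∫ t in Ioo (-T) T, ppart (u t) ^ p ≤
      2 ^ p * ∫ t in Ioo (-T) T, |posSlope u u' t| ^ p :=
  (mul_le_mul_of_nonneg_left (h.integral_ppart_rpow_le hp) hl).trans
    (lam1_mul_le_of_left_eq_zero hp hT (h.memW1pC_posSlope hp) (by simp))

lemma ae_ppart_eq (h : IsAdapted p T u u' m P) (hp : 1 < p) (hT : 0 < T) {φ φ' : ℝ → ℝ}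
    (hφ : IsPrincipalEigenfunction p T φ φ')
    (hE : 2 ^ p * ∫ t in Ioo (-T) T, |posSlope u u' t| ^ p ≤
      lam1 p (-T) T * ∫ t in Ioo (-T) T, ppart (u t) ^ p) :
    ∃ c, 0 ≤ c ∧ ∀ᵐ t ∂(volume.restrict (Ioo (-T) T)), ppart (u t) = c * φ ((t - T) / 2) := by
  have hl := hφ.lam1_pos hp hT
  have hG := h.memW1pC_posSlope hp
  have hle := h.integral_ppart_rpow_le hp
  have hmul := lam1_mul_le_of_left_eq_zero hp hT hG (by simp)
  obtain ⟨c, hc, hcG⟩ := hφ.eq_of_left_eq_zero hp hT hG (by simp)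
    (fun t ht => integral_posSlope_nonneg t ht.1) (hE.trans (mul_le_mul_of_nonneg_left hle hl.le))
  have heq := (integral_eq_iff_of_ae_le (h.integrableOn_ppart_rpow hp)
    (hG.integrableOn_abs_rpow hp h.neg_lt.le) (h.ae_ppart_rpow_le hp)).1
    (hle.antisymm (le_of_mul_le_mul_left (hmul.trans hE) hl))
  refine ⟨c, hc, ?_⟩
  filter_upwards [heq, ae_restrict_mem measurableSet_Ioo] with t ht htI
  have htI' := Ioo_subset_Icc_self htI
  rw [← hcG t htI', Real.rpow_left_injOn (by linarith : p ≠ 0) (ppart_nonneg (u t))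
    (abs_nonneg (∫ r in (-T)..t, posSlope u u' r)) ht,
    abs_of_nonneg (integral_posSlope_nonneg t htI'.1)]

lemma integrableOn_ppart_neg_rpow (h : IsAdapted p T u u' m P) (hp : 1 < p) :
    IntegrableOn (fun t => ppart (-u t) ^ p) (Ioo (-T) T) := by
  have := h.reflect.integrableOn_ppart_rpow hp
  rw [← intervalIntegrable_iff_integrableOn_Ioo_of_le h.neg_lt.le] at this ⊢
  simpa using ((IntervalIntegrable.iff_comp_neg (by simp)).1 this).symm

lemma integrableOn_abs_rpow (h : IsAdapted p T u u' m P) (hp : 1 < p) :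
    IntegrableOn (fun t => |u t| ^ p) (Ioo (-T) T) := by
  simp only [abs_rpow_eq_ppart_add (by linarith : p ≠ 0)]
  exact (h.integrableOn_ppart_rpow hp).add (h.integrableOn_ppart_neg_rpow hp)

lemma integral_abs_rpow_eq (h : IsAdapted p T u u' m P) (hp : 1 < p) (hT : 0 < T) :
    ∫ t in Ioo (-T) T, |u t| ^ p =
      (∫ t in Ioo (-T) T, ppart (u t) ^ p) + ∫ t in Ioo (-T) T, ppart (-u (-t)) ^ p := by
  rw [setIntegral_Ioo_comp_neg hT (fun t => ppart (-u t) ^ p),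
    ← integral_add (h.integrableOn_ppart_rpow hp) (h.integrableOn_ppart_neg_rpow hp)]
  simp only [abs_rpow_eq_ppart_add (by linarith : p ≠ 0)]

lemma integral_posSlope_add_le (h : IsAdapted p T u u' m P) (hp : 1 < p) (hT : 0 < T) :
    (∫ t in Ioo (-T) T, |posSlope u u' t| ^ p) +
      ∫ t in Ioo (-T) T, |posSlope (fun t => -u (-t)) (fun t => u' (-t)) t| ^ p ≤
        ∫ t in Ioo (-T) T, ppart (u' t) ^ p := by
  have hi := (h.reflect.memW1pC_posSlope hp).2.2
  rw [← intervalIntegrable_iff_integrableOn_Ioo_of_le h.neg_lt.le] at hi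
  have hi' := ((IntervalIntegrable.iff_comp_neg (by simp)).1 hi).symm
  rw [neg_neg, intervalIntegrable_iff_integrableOn_Ioo_of_le h.neg_lt.le] at hi'
  rw [← setIntegral_Ioo_comp_neg hT
    (fun t => |posSlope (fun t => -u (-t)) (fun t => u' (-t)) t| ^ p),
    ← integral_add (h.memW1pC_posSlope hp).2.2 hi']
  refine integral_mono ((h.memW1pC_posSlope hp).2.2.add hi') (h.integrableOn_ppart_deriv_rpow hp)
    fun t => ?_
  have hp0 : p ≠ 0 := by linarith
  have hnn := Real.rpow_nonneg (ppart_nonneg (u' t)) p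
  simp only [posSlope, neg_neg]
  rcases lt_trichotomy (u t) 0 with h0 | h0 | h0
  · simp [h0, h0.not_gt, Real.zero_rpow hp0, abs_of_nonneg (ppart_nonneg _)]
  · simpa [h0, Real.zero_rpow hp0] using hnn
  · simp [h0, h0.not_gt, Real.zero_rpow hp0, abs_of_nonneg (ppart_nonneg _)]

lemma lam1_mul_le (h : IsAdapted p T u u' m P) (hp : 1 < p) (hT : 0 < T)
    (hl : 0 ≤ lam1 p (-T) T) :
    lam1 p (-T) T * ∫ t in Ioo (-T) T, |u t| ^ p ≤
      2 ^ p * ∫ t in Ioo (-T) T, ppart (u' t) ^ p := by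
  have h1 := h.lam1_mul_le_posSlope hp hT hl
  have h2 := h.reflect.lam1_mul_le_posSlope hp hT hl
  have h3 := mul_le_mul_of_nonneg_left (h.integral_posSlope_add_le hp hT)
    (Real.rpow_nonneg zero_le_two p)
  rw [h.integral_abs_rpow_eq hp hT]
  linarith

end IsAdapted

lemma IsPrincipalEigenfunction.lam1_eq {p T : ℝ} {φ φ' : ℝ → ℝ} (hp : 1 < p) (hT : 0 < T)
    (hφ : IsPrincipalEigenfunction p T φ φ') : lam1 p (-T) T = 2 ^ p * lamPlus p T := by
  have h2 : (0 : ℝ) < 2 ^ p := Real.rpow_pos_of_pos two_pos p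
  obtain ⟨hψ, hψ1, hψE⟩ := hφ.half hp hT
  apply le_antisymm
  · rw [mul_comm, ← div_le_iff₀ h2]
    refine le_csInf ⟨_, φ, φ', hφ.1, hφ.2.2.1, rfl⟩ ?_
    rintro E ⟨w, w', hw, hw1, rfl⟩
    rw [div_le_iff₀ h2, mul_comm]
    have := (hw.isAdapted hT).lam1_mul_le hp hT (hφ.lam1_pos hp hT).le
    rwa [hw1, mul_one] at this
  · rw [← hψE]
    refine mul_le_mul_of_nonneg_left ?_ h2.le
    have := lamPlus_mul_le_of_left_eq_zero hp hT hψ ?_ fun t ht => ?_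
    · rwa [hψ1, mul_one] at this
    · rw [show (-T - T) / 2 = -T by ring]
      exact hφ.1.2.1
    · rcases eq_or_lt_of_le ht.1 with h0 | h0
      · rw [← h0, show (-T - T) / 2 = -T by ring]
        exact hφ.1.2.1.ge
      · exact (hφ.2.1 _ ⟨by linarith, by linarith [ht.2]⟩).le

lemma IsPrincipalEigenfunction.continuousOn_half {p T : ℝ} {φ φ' : ℝ → ℝ} (hp : 1 < p)
    (hT : 0 < T) (hφ : IsPrincipalEigenfunction p T φ φ') (c : ℝ) :
    ContinuousOn (fun t => c * φ ((t - T) / 2)) (Icc (-T) T) :=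
  ((hφ.half hp hT).1.continuousOn (by linarith)).const_smul c

namespace IsAdapted

variable {p T : ℝ} {u u' : ℝ → ℝ} {m : ℕ} {P : ℕ → ℝ} {φ φ' : ℝ → ℝ}

lemma eq_of_ae_ppart_eq (h : IsAdapted p T u u' m P) (hp : 1 < p) (hT : 0 < T)
    (hφ : IsPrincipalEigenfunction p T φ φ') {c : ℝ} (hc : 0 < c)
    (hae : ∀ᵐ t ∂(volume.restrict (Ioo (-T) T)), ppart (u t) = c * φ ((t - T) / 2)) :
    MemW1pI p (-T) T u u' ∧ ∀ t ∈ Ioo (-T) T, u t = c * φ ((t - T) / 2) := by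
  refine h.eq_of_ae_eq ((hφ.continuousOn_half hp hT c).mono Ioo_subset_Icc_self) ?_
  filter_upwards [hae, ae_restrict_mem measurableSet_Ioo] with t ht htI
  have hpos : 0 < c * φ ((t - T) / 2) :=
    mul_pos hc (hφ.2.1 _ ⟨by linarith [htI.1], by linarith [htI.2]⟩)
  rw [← ht] at hpos ⊢
  rcases le_total (u t) 0 with h0 | h0
  · exact absurd hpos (by simp [ppart, h0])
  · simp [ppart, h0]

/-- The equality case, up to the symmetry `u ↦ -u(-·)`. -/
lemma extremizer_cases (h : IsAdapted p T u u' m P) (hp : 1 < p) (hT : 0 < T)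
    (hφ : IsPrincipalEigenfunction p T φ φ') (hne : ¬ ∀ t ∈ Ioo (-T) T, u t = 0)
    (hE : ∫ t in Ioo (-T) T, ppart (u' t) ^ p = lamPlus p T * ∫ t in Ioo (-T) T, |u t| ^ p) :
    ∃ c > 0, (∀ t ∈ Ioo (-T) T, u t = c * φ ((t - T) / 2)) ∨
      ∀ t ∈ Ioo (-T) T, -u (-t) = c * φ ((t - T) / 2) := by
  have hl := hφ.lam1_pos hp hT
  have h1 := h.lam1_mul_le_posSlope hp hT hl.le
  have h2 := h.reflect.lam1_mul_le_posSlope hp hT hl.le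
  have h3 := mul_le_mul_of_nonneg_left (h.integral_posSlope_add_le hp hT)
    (Real.rpow_nonneg zero_le_two p)
  rw [hE, ← mul_assoc, ← hφ.lam1_eq hp hT, h.integral_abs_rpow_eq hp hT] at h3
  obtain ⟨c, hc, hcu⟩ := h.ae_ppart_eq hp hT hφ (by linarith)
  obtain ⟨d, hd, hdu⟩ := h.reflect.ae_ppart_eq hp hT hφ (by linarith)
  rcases hc.eq_or_lt with rfl | hc
  · rcases hd.eq_or_lt with rfl | hd
    · refine absurd (h.eq_of_ae_eq continuousOn_const ?_).2 hne
      have hp0 : p ≠ 0 := by linarith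
      have hz : (∫ t in Ioo (-T) T, |u t| ^ p) = 0 := by
        rw [h.integral_abs_rpow_eq hp hT]
        rw [integral_eq_zero_of_ae, integral_eq_zero_of_ae, add_zero]
        · filter_upwards [hdu] with t ht
          simp [ht, Real.zero_rpow hp0]
        · filter_upwards [hcu] with t ht
          simp [ht, Real.zero_rpow hp0]
      rw [integral_eq_zero_iff_of_nonneg (fun t => Real.rpow_nonneg (abs_nonneg _) _)
        (h.integrableOn_abs_rpow hp)] at hz
      filter_upwards [hz] with t ht
      simpa [Real.rpow_eq_zero (abs_nonneg _) hp0] using ht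
    · exact ⟨d, hd, Or.inr (h.reflect.eq_of_ae_ppart_eq hp hT hφ hd hdu).2⟩
  · exact ⟨c, hc, Or.inl (h.eq_of_ae_ppart_eq hp hT hφ hc hcu).2⟩

lemma extremal_of_eq (h : IsAdapted p T u u' m P) (hp : 1 < p) (hT : 0 < T)
    (hφ : IsPrincipalEigenfunction p T φ φ') {c : ℝ} (hc : 0 < c)
    (hu : ∀ t ∈ Ioo (-T) T, u t = c * φ ((t - T) / 2)) :
    ∫ t in Ioo (-T) T, ppart (u' t) ^ p = lamPlus p T * ∫ t in Ioo (-T) T, |u t| ^ p := by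
  have hp0 : p ≠ 0 := by linarith
  have h2 : (0 : ℝ) < 2 ^ p := Real.rpow_pos_of_pos two_pos p
  obtain ⟨hψ, hψ1, hψE⟩ := hφ.half hp hT
  have hI := (h.eq_of_ae_eq ((hφ.continuousOn_half hp hT c).mono Ioo_subset_Icc_self)
    ((ae_restrict_iff' measurableSet_Ioo).2 (ae_of_all _ hu))).1
  obtain ⟨v, hv, huv⟩ := hI.exists_memW1pC h.neg_lt
  have hae := hv.ae_eq (hψ.const_mul c) fun t ht => (huv t ht).symm.trans (hu t ht)
  have hle := h.lam1_mul_le hp hT (hφ.lam1_pos hp hT).le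
  rw [hφ.lam1_eq hp hT, mul_assoc] at hle
  refine le_antisymm ?_ (le_of_mul_le_mul_left hle h2)
  have e1 : ∫ t in Ioo (-T) T, |u t| ^ p = c ^ p := by
    rw [setIntegral_congr_fun measurableSet_Ioo (g := fun t => c ^ p * |φ ((t - T) / 2)| ^ p),
      integral_const_mul, hψ1, mul_one]
    intro t ht
    simp only [hu t ht, abs_mul, abs_of_pos hc, Real.mul_rpow hc.le (abs_nonneg _)]
  have e2 : ∫ t in Ioo (-T) T, |u' t| ^ p = c ^ p * lamPlus p T := by
    rw [integral_congr_ae (g := fun t => c ^ p * |φ' ((t - T) / 2) / 2| ^ p),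
      integral_const_mul]
    · rw [hφ.lam1_eq hp hT] at hψE
      rw [mul_left_cancel₀ h2.ne' hψE]
    · filter_upwards [hae] with t ht
      rw [ht, abs_mul, abs_of_pos hc, Real.mul_rpow hc.le (abs_nonneg _)]
  rw [e1, mul_comm, ← e2]
  refine integral_mono (h.integrableOn_ppart_deriv_rpow hp) h.integrableOn_rpow fun t => ?_
  exact Real.rpow_le_rpow (ppart_nonneg _) (ppart_le_abs _) (by linarith)

end IsAdapted

theorem lamPlus_extremizers (p T : ℝ) (hp : 1 < p) (hT : 0 < T)
    (φp φp' : ℝ → ℝ) (hφ : IsPrincipalEigenfunction p T φp φp')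
    (u u' : ℝ → ℝ) (hu : MemWpw p T u u')
    (hne : ¬ ∀ t ∈ Set.Ioo (-T) T, u t = 0) :
    ((∫ t in Set.Ioo (-T) T, ppart (u' t) ^ p)
        = lamPlus p T * ∫ t in Set.Ioo (-T) T, |u t| ^ p
      ↔ ∃ c > 0, (∀ t ∈ Set.Ioo (-T) T, u t = c * φp ((t - T) / 2)) ∨
          (∀ t ∈ Set.Ioo (-T) T, u t = -c * φp ((t + T) / 2))) ∧
    ((∫ t in Set.Ioo (-T) T, ppart (u' t) ^ p)
        = lamPlus p T * ∫ t in Set.Ioo (-T) T, |u t| ^ p →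
      MemW1pI p (-T) T u u' ∧
      (∃ l₀ l₁, Tendsto u (𝓝[>] (-T)) (𝓝 l₀) ∧ Tendsto u (𝓝[<] T) (𝓝 l₁) ∧
        ((l₀ = 0 ∧ l₁ ≠ 0) ∨ (l₀ ≠ 0 ∧ l₁ = 0))) ∧
      ((∀ t ∈ Set.Ioo (-T) T, 0 < u t) ∨ (∀ t ∈ Set.Ioo (-T) T, u t < 0))) := by
  obtain ⟨m, P, h⟩ := hu.exists_isAdapted
  have hlt : -T < T := h.neg_lt
  have hp0 : φp (-T) = 0 := hφ.1.2.1
  have hp1 : φp T = 0 := hφ.1.2.2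
  have hmid : 0 < φp 0 := hφ.2.1 0 ⟨by linarith, hT⟩
  have hsymm : ∀ t ∈ Ioo (-T) T, φp ((-t - T) / 2) = φp ((t + T) / 2) := fun t ht => by
    rw [show (-t - T) / 2 = -((t + T) / 2) by ring]
    exact hφ.even hp hT ⟨by linarith [ht.1], by linarith [ht.2]⟩
  have hneg : ∀ t ∈ Ioo (-T) T, -t ∈ Ioo (-T) T := fun t ht =>
    ⟨by linarith [ht.2], by linarith [ht.1]⟩
  have hcases : (∫ t in Set.Ioo (-T) T, ppart (u' t) ^ p)
        = lamPlus p T * ∫ t in Set.Ioo (-T) T, |u t| ^ p →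
      ∃ c > 0, (∀ t ∈ Set.Ioo (-T) T, u t = c * φp ((t - T) / 2)) ∨
          (∀ t ∈ Set.Ioo (-T) T, u t = -c * φp ((t + T) / 2)) := by
    intro hE
    obtain ⟨c, hc, hcu | hcu⟩ := h.extremizer_cases hp hT hφ hne hE
    · exact ⟨c, hc, Or.inl hcu⟩
    · refine ⟨c, hc, Or.inr fun t ht => ?_⟩
      have := hcu (-t) (hneg t ht)
      rw [neg_neg, hsymm t ht] at this
      linarith
  refine ⟨⟨hcases, ?_⟩, fun hE => ?_⟩
  · rintro ⟨c, hc, hcu | hcu⟩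
    · exact h.extremal_of_eq hp hT hφ hc hcu
    · have := h.reflect.extremal_of_eq hp hT hφ hc fun t ht => by
        rw [hcu (-t) (hneg t ht), ← hsymm (-t) (hneg t ht), neg_neg]
        ring
      simp only [abs_neg] at this
      rwa [setIntegral_Ioo_comp_neg hT (fun t => ppart (u' t) ^ p),
        setIntegral_Ioo_comp_neg hT (fun t => |u t| ^ p)] at this
  · obtain ⟨c, hc, hcu | hcu⟩ := hcases hE
    · have hf := hφ.continuousOn_half hp hT c
      obtain ⟨h0, h1⟩ := tendsto_endpoints_of_eqOn hlt hf hcu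
      refine ⟨(h.eq_of_ae_eq (hf.mono Ioo_subset_Icc_self)
        ((ae_restrict_iff' measurableSet_Ioo).2 (ae_of_all _ hcu))).1,
        ⟨_, _, h0, h1, Or.inl ⟨?_, ?_⟩⟩, Or.inl fun t ht => ?_⟩
      · rw [show (-T - T) / 2 = -T by ring, hp0, mul_zero]
      · rw [sub_self, zero_div]
        exact (mul_pos hc hmid).ne'
      · rw [hcu t ht]
        exact mul_pos hc (hφ.2.1 _ ⟨by linarith [ht.1], by linarith [ht.2]⟩)
    · have hf : ContinuousOn (fun t => -c * φp ((t + T) / 2)) (Icc (-T) T) :=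
        ((hφ.1.1.continuousOn hlt.le).comp (f := fun t => (t + T) / 2) (by fun_prop)
          fun t ht => ⟨by linarith [ht.1], by linarith [ht.2]⟩).const_smul (-c)
      obtain ⟨h0, h1⟩ := tendsto_endpoints_of_eqOn hlt hf hcu
      refine ⟨(h.eq_of_ae_eq (hf.mono Ioo_subset_Icc_self)
        ((ae_restrict_iff' measurableSet_Ioo).2 (ae_of_all _ hcu))).1,
        ⟨_, _, h0, h1, Or.inr ⟨?_, ?_⟩⟩, Or.inr fun t ht => ?_⟩
      · rw [neg_add_cancel, zero_div]
        exact (mul_neg_of_neg_of_pos (neg_lt_zero.2 hc) hmid).ne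
      · rw [show (T + T) / 2 = T by ring, hp1, mul_zero]
      · rw [hcu t ht]
        exact mul_neg_of_neg_of_pos (neg_lt_zero.2 hc)
          (hφ.2.1 _ ⟨by linarith [ht.1], by linarith [ht.2]⟩)

end
end

section
/- Let H be a nonzero asymmetric anisotropy on ℝ² such that ker(H) := {v ∈ ℝ² : H(v) = 0} is a line or a closed half-plane. Then there exists a rotation matrix A such that: (i) if ker(H) is a line, then H(A(x,y)) = a y^+ + b y^- for all (x,y) ∈ ℝ², for some constants a, b > 0; (ii) if ker(H) is a half-plane, then H(A(x,y)) = a y^+ for all (x,y) ∈ ℝ², for some constant a > 0. -/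
open MeasureTheory Filter Set
open scoped Topology RealInnerProductSpace

noncomputable section

/-- The linear map sending `e₀, e₁` to `(n₁, -n₀), (n₀, n₁)`. -/
def rotMap (n : V2) : V2 →ₗ[ℝ] V2 :=
  Matrix.toLin (EuclideanSpace.basisFun (Fin 2) ℝ).toBasis (EuclideanSpace.basisFun (Fin 2) ℝ).toBasis
    !![n 1, n 0; -n 0, n 1]

lemma rotMap_apply (n v : V2) : rotMap n v = v 0 • !₂[n 1, -n 0] + v 1 • n := by
  rw [rotMap, Matrix.toLin_apply]
  ext i
  fin_cases i <;> simp [Matrix.mulVec, dotProduct, Fin.sum_univ_two] <;> ring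

lemma sq_add_sq_of_norm_eq_one {n : V2} (hn : ‖n‖ = 1) : n 0 ^ 2 + n 1 ^ 2 = 1 := by
  have h := EuclideanSpace.real_norm_sq_eq n
  rw [hn, Fin.sum_univ_two] at h
  linarith

lemma norm_rotMap {n : V2} (hn : ‖n‖ = 1) (v : V2) : ‖rotMap n v‖ = ‖v‖ := by
  have hn' := sq_add_sq_of_norm_eq_one hn
  rw [← sq_eq_sq₀ (norm_nonneg _) (norm_nonneg _), EuclideanSpace.real_norm_sq_eq,
    EuclideanSpace.real_norm_sq_eq, rotMap_apply]
  simp only [Fin.sum_univ_two, PiLp.add_apply, PiLp.smul_apply, smul_eq_mul]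
  simp
  linear_combination (v 0 ^ 2 + v 1 ^ 2) * hn'

lemma exists_isRotation {n : V2} (hn : ‖n‖ = 1) :
    ∃ A : V2 ≃ₗᵢ[ℝ] V2, IsRotation A ∧ ∀ v, A v = v 0 • !₂[n 1, -n 0] + v 1 • n := by
  let L : V2 →ₗᵢ[ℝ] V2 := ⟨rotMap n, norm_rotMap hn⟩
  refine ⟨L.toLinearIsometryEquiv rfl, ?_, fun v => rotMap_apply n v⟩
  have hL : ((L.toLinearIsometryEquiv rfl).toLinearEquiv : V2 →ₗ[ℝ] V2) = rotMap n := by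
    ext1 v
    rfl
  rw [IsRotation, hL, rotMap, LinearMap.det_toLin, Matrix.det_fin_two_of]
  linarith [sq_add_sq_of_norm_eq_one hn]

namespace IsAnisotropy

variable {H : V2 → ℝ}

lemma map_zero (hH : IsAnisotropy H) : H 0 = 0 := by
  have h := hH.2.2 2 two_pos 0
  rw [smul_zero] at h
  linarith

lemma map_add_le (hH : IsAnisotropy H) (x y : V2) : H (x + y) ≤ H x + H y := by
  have h := hH.2.1.2 (mem_univ x) (mem_univ y) (by norm_num : (0 : ℝ) ≤ 1 / 2)
    (by norm_num : (0 : ℝ) ≤ 1 / 2) (by norm_num)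
  rw [← smul_add, hH.2.2 _ (by norm_num), smul_eq_mul, smul_eq_mul] at h
  linarith

lemma map_add_of_eq_zero (hH : IsAnisotropy H) {x : V2} (hx : H x = 0) (hx' : H (-x) = 0)
    (y : V2) : H (x + y) = H y := by
  have h₁ := hH.map_add_le x y
  have h₂ := hH.map_add_le (-x) (x + y)
  rw [neg_add_cancel_left] at h₂
  linarith

lemma map_smul_eq (hH : IsAnisotropy H) (t : ℝ) (n : V2) :
    H (t • n) = H n * ppart t + H (-n) * npart t := by
  unfold ppart npart
  rcases lt_trichotomy t 0 with ht | rfl | ht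
  · have h := hH.2.2 (-t) (neg_pos.2 ht) (-n)
    rw [smul_neg, neg_smul, neg_neg] at h
    rw [h, max_eq_right ht.le, max_eq_left (neg_pos.2 ht).le]
    ring
  · simp [hH.map_zero]
  · rw [hH.2.2 t ht, max_eq_left ht.le, max_eq_right (neg_neg_of_pos ht).le]
    ring

/-- An anisotropy vanishing on the line orthogonal to the unit vector `n` depends, up to a
rotation, on the second coordinate only. -/
lemma exists_isRotation_apply_eq (hH : IsAnisotropy H) {n : V2} (hn : ‖n‖ = 1)
    (hker : ∀ w : V2, ⟪n, w⟫ = 0 → H w = 0) :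
    ∃ A : V2 ≃ₗᵢ[ℝ] V2, IsRotation A ∧
      ∀ v, H (A v) = H n * ppart (v 1) + H (-n) * npart (v 1) := by
  obtain ⟨A, hA, hAv⟩ := exists_isRotation hn
  refine ⟨A, hA, fun v => ?_⟩
  have h : ⟪n, v 0 • !₂[n 1, -n 0]⟫ = 0 := by
    simp [PiLp.inner_apply, Fin.sum_univ_two]
    ring
  rw [hAv, hH.map_add_of_eq_zero (hker _ h) (hker _ (by rw [inner_neg_right, h, neg_zero])),
    hH.map_smul_eq]

end IsAnisotropy

lemma not_isClosedHalfPlane_of_isLine {S : Set V2} (hS : IsLine S) : ¬ IsClosedHalfPlane S := by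
  rintro ⟨n, hn, hSn⟩
  obtain ⟨v, -, hSv⟩ := hS
  have h₁ : -n ∈ S := by
    rw [hSn]
    simp [inner_neg_right]
  rw [hSv] at h₁
  obtain ⟨t, ht⟩ := h₁
  have h₂ : n ∈ S := by
    rw [hSv]
    exact ⟨-t, by rw [neg_smul, ← ht, neg_neg]⟩
  rw [hSn, mem_ofPred_eq] at h₂
  exact h₂.not_gt (real_inner_self_pos.2 hn)

/-- Every line through the origin is the orthogonal complement of a unit vector. -/
lemma IsLine.exists_unit_normal {S : Set V2} (hS : IsLine S) :
    ∃ n : V2, ‖n‖ = 1 ∧ S = {w | ⟪n, w⟫ = 0} := by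
  obtain ⟨v, hv, rfl⟩ := hS
  have hv' : v 0 ^ 2 + v 1 ^ 2 ≠ 0 := by
    have h := EuclideanSpace.real_norm_sq_eq v
    rw [Fin.sum_univ_two] at h
    rw [← h]
    exact pow_ne_zero 2 (norm_ne_zero_iff.2 hv)
  have hm : (!₂[-v 1, v 0] : V2) ≠ 0 := by
    intro h
    have h₀ := congrArg (fun w : V2 => w 0) h
    have h₁ := congrArg (fun w : V2 => w 1) h
    simp at h₀ h₁
    simp [h₀, h₁] at hv'
  refine ⟨(‖(!₂[-v 1, v 0] : V2)‖)⁻¹ • !₂[-v 1, v 0], norm_smul_inv_norm hm, ?_⟩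
  ext w
  simp only [mem_ofPred_eq, inner_smul_left, mul_eq_zero]
  simp only [PiLp.inner_apply, Fin.sum_univ_two]
  simp [hm]
  constructor
  · rintro ⟨t, rfl⟩
    simp
    ring
  · intro h
    refine ⟨(v 0 * w 0 + v 1 * w 1) / (v 0 ^ 2 + v 1 ^ 2), ?_⟩
    ext i
    fin_cases i
    · simp
      field_simp
      linear_combination -v 1 * h
    · simp
      field_simp
      linear_combination v 0 * h

lemma IsClosedHalfPlane.exists_unit_normal {S : Set V2} (hS : IsClosedHalfPlane S) :
    ∃ n : V2, ‖n‖ = 1 ∧ S = {w | ⟪n, w⟫ ≤ 0} := by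
  obtain ⟨v, hv, rfl⟩ := hS
  refine ⟨‖v‖⁻¹ • v, norm_smul_inv_norm hv, ?_⟩
  ext w
  have h : 0 < ‖v‖⁻¹ := inv_pos.2 (norm_pos_iff.2 hv)
  simp only [mem_ofPred_eq, real_inner_smul_left]
  exact (mul_nonpos_iff_pos_imp_nonpos.trans (by simp [h, h.le])).symm

lemma pos_of_notMem_kerH {H : V2 → ℝ} (hH : IsAnisotropy H) {v : V2} (hv : v ∉ kerH H) : 0 < H v :=
  (hH.1 v).lt_of_ne' hv

theorem kernel_normal_form (H : V2 → ℝ) (hH : IsAnisotropy H) (hne : H ≠ 0)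
    (hker : IsLine (kerH H) ∨ IsClosedHalfPlane (kerH H)) :
    ∃ A : V2 ≃ₗᵢ[ℝ] V2, IsRotation A ∧
      (IsLine (kerH H) →
        ∃ a b : ℝ, 0 < a ∧ 0 < b ∧ ∀ v : V2, H (A v) = a * ppart (v 1) + b * npart (v 1)) ∧
      (IsClosedHalfPlane (kerH H) →
        ∃ a : ℝ, 0 < a ∧ ∀ v : V2, H (A v) = a * ppart (v 1)) := by
  rcases hker with hl | hp
  · obtain ⟨n, hn, hS⟩ := hl.exists_unit_normal
    obtain ⟨A, hA, hAv⟩ := hH.exists_isRotation_apply_eq hn fun w hw => by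
      have : w ∈ kerH H := hS ▸ hw
      exact this
    refine ⟨A, hA, fun _ => ⟨H n, H (-n), ?_, ?_, hAv⟩,
      fun hp => (not_isClosedHalfPlane_of_isLine hl hp).elim⟩ <;>
    · apply pos_of_notMem_kerH hH
      rw [hS]
      simp [hn]
  · obtain ⟨n, hn, hS⟩ := hp.exists_unit_normal
    obtain ⟨A, hA, hAv⟩ := hH.exists_isRotation_apply_eq hn fun w hw => by
      have : w ∈ kerH H := hS ▸ hw.le
      exact this
    refine ⟨A, hA, fun hl => (not_isClosedHalfPlane_of_isLine hl hp).elim, fun _ => ⟨H n, ?_, ?_⟩⟩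
    · apply pos_of_notMem_kerH hH
      rw [hS]
      simp [hn]
    · have h : -n ∈ kerH H := by
        rw [hS]
        simp [hn]
      intro v
      rw [hAv, show H (-n) = 0 from h, zero_mul, add_zero]

end
end

section
/- Let H be a nonzero asymmetric anisotropy on ℝ² and set ‖H‖ := max{H(v) : |v| = 1}. Then there exists a rotation matrix A such that H(A(x,y)) ≥ ‖H‖ · y^+ for every (x,y) ∈ ℝ². -/
open MeasureTheory Filter Set
open scoped Topology RealInnerProductSpace

noncomputable section

theorem IsAnisotropy.add_le {H : V2 → ℝ} (hH : IsAnisotropy H) (v w : V2) :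
    H (v + w) ≤ H v + H w := by
  obtain ⟨-, hconv, hhom⟩ := hH
  have h := hconv.2 (mem_univ v) (mem_univ w) (by norm_num : (0 : ℝ) ≤ 1 / 2)
    (by norm_num : (0 : ℝ) ≤ 1 / 2) (by norm_num)
  rw [← smul_add, hhom _ (by norm_num)] at h
  simp only [smul_eq_mul] at h
  linarith

theorem IsAnisotropy.exists_isMaxOn_sphere {H : V2 → ℝ} (hH : IsAnisotropy H) :
    ∃ w : V2, ‖w‖ = 1 ∧ H w = normH H ∧ ∀ v, ‖v‖ = 1 → H v ≤ normH H := by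
  have hcont : ContinuousOn H (Metric.sphere 0 1) :=
    (hH.2.1.continuousOn isOpen_univ).mono (subset_univ _)
  have hne : (Metric.sphere (0 : V2) 1).Nonempty := NormedSpace.sphere_nonempty.2 zero_le_one
  obtain ⟨w, hw, hsup, hmax⟩ :=
    (isCompact_sphere (0 : V2) 1).exists_sSup_image_eq_and_ge hne hcont
  refine ⟨w, by simpa using hw, hsup.symm, fun v hv => ?_⟩
  exact (hmax v (by simpa using hv)).trans_eq hsup.symm

theorem IsAnisotropy.le_normH_mul_norm {H : V2 → ℝ} (hH : IsAnisotropy H) (v : V2) (hv : v ≠ 0) :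
    H v ≤ normH H * ‖v‖ := by
  obtain ⟨w, -, -, hmax⟩ := hH.exists_isMaxOn_sphere
  have hpos : 0 < ‖v‖ := norm_pos_iff.2 hv
  have h := hmax (‖v‖⁻¹ • v) (norm_smul_inv_norm (𝕜 := ℝ) hv)
  rw [hH.2.2 _ (inv_pos.2 hpos)] at h
  rwa [inv_mul_le_iff₀ hpos, mul_comm] at h

/-- At a maximum point `w` of `H` on the unit circle, `normH H • w` is a subgradient of `H`. -/
theorem IsAnisotropy.normH_mul_inner_le {H : V2 → ℝ} (hH : IsAnisotropy H) {w : V2}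
    (hw : ‖w‖ = 1) (hmax : H w = normH H) (v : V2) : normH H * ⟪w, v⟫ ≤ H v := by
  have hnonneg : 0 ≤ normH H := hmax ▸ hH.1 w
  have key : ∀ t : ℝ, ‖v‖ < t → normH H * ⟪w, v⟫ - normH H * ‖v‖ ^ 2 / 2 * t⁻¹ ≤ H v := by
    intro t ht
    have htpos : 0 < t := (norm_nonneg v).trans_lt ht
    have hne : t • w - v ≠ 0 := by
      intro h
      have := congrArg norm (sub_eq_zero.1 h)
      rw [norm_smul, hw, Real.norm_of_nonneg htpos.le] at this
      linarith
    have hadd := hH.add_le (t • w - v) v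
    rw [sub_add_cancel, hH.2.2 t htpos, hmax] at hadd
    have hle := hH.le_normH_mul_norm _ hne
    have hsq : ‖t • w - v‖ ^ 2 = t ^ 2 - 2 * (t * ⟪w, v⟫) + ‖v‖ ^ 2 := by
      rw [norm_sub_sq_real, norm_smul, hw, real_inner_smul_left, Real.norm_of_nonneg htpos.le]
      ring
    have hnorm : ‖t • w - v‖ ≤ t - ⟪w, v⟫ + ‖v‖ ^ 2 / 2 * t⁻¹ := by
      have : t - ⟪w, v⟫ + ‖v‖ ^ 2 / 2 * t⁻¹ - ‖t • w - v‖ =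
          (‖t • w - v‖ - t) ^ 2 / (2 * t) := by
        field_simp
        linear_combination -hsq
      have : 0 ≤ (‖t • w - v‖ - t) ^ 2 / (2 * t) := by positivity
      linarith
    have := mul_le_mul_of_nonneg_left hnorm hnonneg
    linarith
  have hlim : Tendsto (fun t : ℝ => normH H * ⟪w, v⟫ - normH H * ‖v‖ ^ 2 / 2 * t⁻¹) atTop
      (𝓝 (normH H * ⟪w, v⟫ - normH H * ‖v‖ ^ 2 / 2 * 0)) :=
    (tendsto_inv_atTop_zero.const_mul _).const_sub _
  rw [mul_zero, sub_zero] at hlim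
  exact le_of_tendsto hlim ((eventually_gt_atTop _).mono key)

/-- Every unit vector is the image of the second basis vector under a rotation. -/
theorem exists_isRotation_inner_eq {w : V2} (hw : ‖w‖ = 1) :
    ∃ A : V2 ≃ₗᵢ[ℝ] V2, IsRotation A ∧ ∀ v, ⟪w, A v⟫ = v 1 := by
  have hsq : w 0 ^ 2 + w 1 ^ 2 = 1 := by
    have := EuclideanSpace.real_norm_sq_eq w
    rw [hw, Fin.sum_univ_two] at this
    linarith
  let f : V2 →ₗ[ℝ] V2 := Matrix.toEuclideanLin !![w 1, w 0; -w 0, w 1]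
  have hf0 (v : V2) : f v 0 = w 1 * v 0 + w 0 * v 1 := by
    simp [f, Matrix.mulVec, dotProduct, Fin.sum_univ_two]
  have hf1 (v : V2) : f v 1 = -w 0 * v 0 + w 1 * v 1 := by
    simp [f, Matrix.mulVec, dotProduct, Fin.sum_univ_two]
  have hnorm (v : V2) : ‖f v‖ = ‖v‖ := by
    rw [← sq_eq_sq₀ (norm_nonneg _) (norm_nonneg _), EuclideanSpace.real_norm_sq_eq,
      EuclideanSpace.real_norm_sq_eq, Fin.sum_univ_two, Fin.sum_univ_two, hf0, hf1]
    linear_combination (v 0 ^ 2 + v 1 ^ 2) * hsq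
  have hdet : LinearMap.det f = 1 := by
    simp only [f, Matrix.toLpLin_eq_toLin, LinearMap.det_toLin, Matrix.det_fin_two_of]
    linear_combination hsq
  refine ⟨LinearIsometry.toLinearIsometryEquiv ⟨f, hnorm⟩ rfl, ?_, fun v => ?_⟩
  · have h : ((LinearIsometry.toLinearIsometryEquiv ⟨f, hnorm⟩ rfl).toLinearEquiv :
        V2 →ₗ[ℝ] V2) = f := by
      ext; rfl
    rw [IsRotation, h, hdet]
    exact one_pos
  · have h : (LinearIsometry.toLinearIsometryEquiv ⟨f, hnorm⟩ rfl) v = f v := rfl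
    rw [h, PiLp.inner_apply, Fin.sum_univ_two, hf0, hf1]
    simp only [RCLike.inner_apply, conj_trivial]
    linear_combination v 1 * hsq

theorem anisotropy_lower_bound (H : V2 → ℝ) (hH : IsAnisotropy H) (hne : H ≠ 0) :
    ∃ A : V2 ≃ₗᵢ[ℝ] V2, IsRotation A ∧ ∀ v : V2, normH H * ppart (v 1) ≤ H (A v) := by
  obtain ⟨w, hw, hmax, -⟩ := hH.exists_isMaxOn_sphere
  obtain ⟨A, hA, hinner⟩ := exists_isRotation_inner_eq hw
  refine ⟨A, hA, fun v => ?_⟩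
  rcases le_total (v 1) 0 with h | h
  · simpa [ppart, max_eq_right h] using hH.1 (A v)
  · simpa [ppart, max_eq_left h, hinner] using hH.normH_mul_inner_le hw hmax (A v)

end
end
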